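/- Let f ∈ L_p^0(T²) with 1<p<∞, let n₁,n₂ ∈ {0,1,2,...}, and let α₁,α₂>0. Then Y_{n₁,n₂}(f)_p ≲ ω_{α₁,α₂}(f, π/(n₁+1), π/(n₂+1))_p ≲ (n₁+1)^{−α₁}(n₂+1)^{−α₂} Σ_{ν₁=1}^{n₁+1} Σ_{ν₂=1}^{n₂+1} ν₁^{α₁−1} ν₂^{α₂−1} Y_{ν₁−1,ν₂−1}(f)_p (Jackson and Bernstein–Stechkin type inequalities for angular approximation). -/

import Mathlib

open MeasureTheory Real
open scoped ENNReal

noncomputable section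

/-- The `L_p` norm of a function of two variables over the period square `(0,2π]²`. -/
def Lp2Norm (p : ℝ) (f : ℝ → ℝ → ℝ) : ℝ≥0∞ :=
  (∫⁻ x in Set.Ioc (0:ℝ) (2*π), ∫⁻ y in Set.Ioc (0:ℝ) (2*π),
      ENNReal.ofReal (|f x y| ^ p)) ^ (1/p)

/-- `f ∈ L_p^0(T²)`: measurable, `2π`-periodic in each variable, finite `L_p` norm,
and zero mean in each variable separately. -/
structure MemLp0 (p : ℝ) (f : ℝ → ℝ → ℝ) : Prop where
  meas : Measurable (Function.uncurry f)
  periodic_x : ∀ y, Function.Periodic (fun x => f x y) (2*π)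
  periodic_y : ∀ x, Function.Periodic (f x) (2*π)
  norm_ne_top : Lp2Norm p f ≠ ⊤
  mean_x : ∀ᵐ (y : ℝ) ∂volume, (∫ x in (0:ℝ)..(2*π), f x y) = 0
  mean_y : ∀ᵐ (x : ℝ) ∂volume, (∫ y in (0:ℝ)..(2*π), f x y) = 0

/-- Generalized (fractional) binomial coefficient `C(α,ν) = α(α-1)⋯(α-ν+1)/ν!`. -/
def fracBinom (α : ℝ) : ℕ → ℝ
  | 0 => 1
  | n+1 => fracBinom α n * (α - (n : ℝ)) / ((n : ℝ) + 1)

/-- Fractional difference of order `α` with step `h` in the first variable. -/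
def diffX (α h : ℝ) (f : ℝ → ℝ → ℝ) : ℝ → ℝ → ℝ :=
  fun x y => ∑' ν : ℕ, (-1 : ℝ) ^ ν * fracBinom α ν * f (x + (α - (ν : ℝ)) * h) y

/-- Fractional difference of order `α` with step `h` in the second variable. -/
def diffY (α h : ℝ) (f : ℝ → ℝ → ℝ) : ℝ → ℝ → ℝ :=
  fun x y => ∑' ν : ℕ, (-1 : ℝ) ^ ν * fracBinom α ν * f x (y + (α - (ν : ℝ)) * h)

/-- The mixed (fractional) modulus of smoothness `ω_{α₁,α₂}(f, δ₁, δ₂)_p`. -/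
def mixedMod (p α₁ α₂ δ₁ δ₂ : ℝ) (f : ℝ → ℝ → ℝ) : ℝ≥0∞ :=
  ⨆ (h₁ : ℝ) (_ : |h₁| ≤ δ₁) (h₂ : ℝ) (_ : |h₂| ≤ δ₂),
    Lp2Norm p (diffX α₁ h₁ (diffY α₂ h₂ f))

/-- `T` is (an `L_p(T²)` function which is) a trigonometric polynomial of degree
at most `m` in the first variable. -/
def TrigPolyX (p : ℝ) (m : ℕ) (T : ℝ → ℝ → ℝ) : Prop :=
  Measurable (Function.uncurry T) ∧ Lp2Norm p T ≠ ⊤ ∧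
  (∀ x, Function.Periodic (T x) (2*π)) ∧
  ∃ a b : ℕ → ℝ → ℝ, ∀ x y,
    T x y = ∑ k ∈ Finset.range (m+1),
      (a k y * Real.cos ((k : ℝ) * x) + b k y * Real.sin ((k : ℝ) * x))

/-- `T` is (an `L_p(T²)` function which is) a trigonometric polynomial of degree
at most `m` in the second variable. -/
def TrigPolyY (p : ℝ) (m : ℕ) (T : ℝ → ℝ → ℝ) : Prop :=
  Measurable (Function.uncurry T) ∧ Lp2Norm p T ≠ ⊤ ∧
  (∀ y, Function.Periodic (fun x => T x y) (2*π)) ∧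
  ∃ a b : ℕ → ℝ → ℝ, ∀ x y,
    T x y = ∑ k ∈ Finset.range (m+1),
      (a k x * Real.cos ((k : ℝ) * y) + b k x * Real.sin ((k : ℝ) * y))

/-- The best angular approximation `Y_{m₁,m₂}(f)_p`. -/
def Yapprox (p : ℝ) (m₁ m₂ : ℕ) (f : ℝ → ℝ → ℝ) : ℝ≥0∞ :=
  ⨅ (T₁ : ℝ → ℝ → ℝ) (_ : TrigPolyX p m₁ T₁) (T₂ : ℝ → ℝ → ℝ) (_ : TrigPolyY p m₂ T₂),
    Lp2Norm p (fun x y => f x y - T₁ x y - T₂ x y)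

/-- The coefficients `(-1)^n C(α,n)` of the fractional difference of order `α`. -/
def diffCoeff (α : ℝ) (n : ℕ) : ℝ := (-1) ^ n * fracBinom α n

theorem fracBinom_eq_choose (α : ℝ) (n : ℕ) : fracBinom α n = Ring.choose α n := by
  rw [Ring.choose_eq_smul]
  induction n with
  | zero => simp [fracBinom]
  | succ n ih =>
    rw [fracBinom, ih, descPochhammer_succ_right, Polynomial.smeval_mul, Nat.factorial_succ]
    simp only [Polynomial.smeval_sub, Polynomial.smeval_X, Polynomial.smeval_natCast, smul_eq_mul,
      pow_one, pow_zero, nsmul_eq_mul, mul_one]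
    have := Nat.factorial_ne_zero n
    push_cast
    field_simp

theorem diffCoeff_zero_right (α : ℝ) : diffCoeff α 0 = 1 := by simp [diffCoeff, fracBinom]

theorem diffCoeff_succ (α : ℝ) (n : ℕ) :
    diffCoeff α (n + 1) = diffCoeff α n * (n - α) / (n + 1) := by
  simp only [diffCoeff, fracBinom]; ring

theorem diffCoeff_add (α β : ℝ) (n : ℕ) :
    diffCoeff (α + β) n =
      ∑ ij ∈ Finset.HasAntidiagonal.antidiagonal n, diffCoeff α ij.1 * diffCoeff β ij.2 := by
  simp only [diffCoeff, fracBinom_eq_choose, Ring.add_choose_eq n (Commute.all α β),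
    Finset.mul_sum]
  refine Finset.sum_congr rfl fun ij hij => ?_
  rw [← Finset.HasAntidiagonal.mem_antidiagonal.1 hij, pow_add]; ring

theorem diffCoeff_add_one (α : ℝ) (n : ℕ) :
    diffCoeff (α + 1) (n + 1) = diffCoeff α (n + 1) - diffCoeff α n := by
  simp only [diffCoeff, fracBinom_eq_choose, Ring.choose_succ_succ]; ring

theorem diffCoeff_succ_eq_sum (β : ℝ) (n : ℕ) :
    diffCoeff β (n + 1) = -(β / (n + 1)) * ∑ i ∈ Finset.range (n + 1), diffCoeff β i := by
  induction n with
  | zero => simp [diffCoeff, fracBinom]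
  | succ n ih =>
    rw [Finset.sum_range_succ, diffCoeff_succ, ih]
    push_cast
    field_simp
    ring

theorem sum_diffCoeff_succ (β : ℝ) (n : ℕ) :
    ∑ i ∈ Finset.range (n + 2), diffCoeff β i =
      (1 - β / (n + 1)) * ∑ i ∈ Finset.range (n + 1), diffCoeff β i := by
  rw [Finset.sum_range_succ, diffCoeff_succ_eq_sum]; ring

theorem sum_diffCoeff_mem {β : ℝ} (h0 : 0 ≤ β) (h1 : β ≤ 1) (n : ℕ) :
    0 ≤ ∑ i ∈ Finset.range (n + 1), diffCoeff β i ∧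
      ∑ i ∈ Finset.range (n + 1), diffCoeff β i ≤ ((n : ℝ) + 1) ^ (-β) := by
  induction n with
  | zero => simp [diffCoeff_zero_right]
  | succ n ih =>
    have hn : (0 : ℝ) < n + 1 := by positivity
    have hle : β / (n + 1) ≤ 1 := by rw [div_le_one hn]; linarith [(n.cast_nonneg : (0 : ℝ) ≤ n)]
    have hb : 0 ≤ β / (n + 1) := by positivity
    rw [sum_diffCoeff_succ]
    refine ⟨mul_nonneg (by linarith) ih.1, ?_⟩
    have hrw : ((n : ℝ) + 1 + 1) ^ (-β) = ((n : ℝ) + 1) ^ (-β) * (1 + 1 / ((n : ℝ) + 1)) ^ (-β) := by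
      rw [← mul_rpow hn.le (by positivity)]; congr 1; field_simp
    have hB : (1 + 1 / ((n : ℝ) + 1)) ^ β ≤ 1 + β / (n + 1) := by
      have := rpow_one_add_le_one_add_mul_self (s := 1 / ((n : ℝ) + 1))
        (by linarith [show (0 : ℝ) ≤ 1 / ((n : ℝ) + 1) by positivity]) h0 h1
      calc _ ≤ _ := this
        _ = _ := by ring
    have hpos : 0 < (1 + 1 / ((n : ℝ) + 1)) ^ β := by positivity
    have hC : 1 - β / (n + 1) ≤ (1 + 1 / ((n : ℝ) + 1)) ^ (-β) := by
      rw [rpow_neg (by positivity), ← one_div, le_div_iff₀ hpos]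
      nlinarith
    push_cast
    rw [hrw, mul_comm]
    exact mul_le_mul ih.2 hC (by linarith) (by positivity)

theorem abs_diffCoeff_succ {β : ℝ} (h0 : 0 ≤ β) (h1 : β ≤ 1) (n : ℕ) :
    |diffCoeff β (n + 1)| = ∑ i ∈ Finset.range (n + 1), diffCoeff β i -
      ∑ i ∈ Finset.range (n + 2), diffCoeff β i := by
  rw [Finset.sum_range_succ _ (n + 1), abs_of_nonpos, sub_add_cancel_left]
  rw [diffCoeff_succ_eq_sum]
  have := (sum_diffCoeff_mem h0 h1 n).1
  have : 0 ≤ β / (n + 1) := by positivity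
  nlinarith

theorem sum_abs_diffCoeff_tail {β : ℝ} (h0 : 0 ≤ β) (h1 : β ≤ 1) (M k : ℕ) :
    ∑ i ∈ Finset.range k, |diffCoeff β (i + (M + 1))| ≤
      ∑ i ∈ Finset.range (M + 1), diffCoeff β i := by
  have : ∑ i ∈ Finset.range k, |diffCoeff β (i + (M + 1))| =
      ∑ i ∈ Finset.range (M + 1), diffCoeff β i -
        ∑ i ∈ Finset.range (M + k + 1), diffCoeff β i := by
    induction k with
    | zero => simp
    | succ k ih =>
      rw [Finset.sum_range_succ, ih, show k + (M + 1) = (M + k) + 1 by ring,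
        abs_diffCoeff_succ h0 h1]
      simp [add_assoc]
  rw [this]
  linarith [(sum_diffCoeff_mem h0 h1 (M + k)).1]

theorem summable_abs_diffCoeff {α : ℝ} (hα : 0 ≤ α) : Summable fun n => |diffCoeff α n| := by
  have key : ∀ (r : ℕ) (β : ℝ), 0 ≤ β → β ≤ 1 → Summable fun n => |diffCoeff (β + r) n| := by
    intro r β h0 h1
    induction r with
    | zero =>
      simp only [Nat.cast_zero, add_zero]
      exact (summable_nat_add_iff 1).1
        (summable_of_sum_range_le (fun _ => abs_nonneg _) (sum_abs_diffCoeff_tail h0 h1 0))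
    | succ r ih =>
      refine (summable_nat_add_iff 1).1 (Summable.of_nonneg_of_le (fun _ => abs_nonneg _)
        (fun n => ?_) (((summable_nat_add_iff 1).2 ih).add ih))
      push_cast
      rw [← add_assoc, diffCoeff_add_one]
      exact abs_sub _ _
  have := key ⌊α⌋₊ (α - ⌊α⌋₊) (sub_nonneg.2 (Nat.floor_le hα))
    (by linarith [Nat.lt_floor_add_one α])
  simpa using this

section Banach

variable {A : Type*} [NormedRing A] [NormedAlgebra ℝ A] {U : A} {α β : ℝ}

/-- The fractional power `(1 - U)^α`, defined by its binomial series. -/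
def oneSubRpow (α : ℝ) (U : A) : A := ∑' n, diffCoeff α n • U ^ n

theorem summable_norm_diffCoeff_smul (hα : 0 ≤ α) (hU : ∀ n, ‖U ^ n‖ ≤ 1) :
    Summable fun n => ‖diffCoeff α n • U ^ n‖ := by
  refine Summable.of_nonneg_of_le (fun _ => norm_nonneg _) (fun n => ?_)
    (summable_abs_diffCoeff hα)
  rw [norm_smul, norm_eq_abs]
  exact mul_le_of_le_one_right (abs_nonneg _) (hU n)

theorem norm_oneSubRpow_le (hα : 0 ≤ α) (hU : ∀ n, ‖U ^ n‖ ≤ 1) :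
    ‖oneSubRpow α U‖ ≤ ∑' n, |diffCoeff α n| := by
  refine tsum_of_norm_bounded (summable_abs_diffCoeff hα).hasSum fun n => ?_
  rw [norm_smul, norm_eq_abs]
  exact mul_le_of_le_one_right (abs_nonneg _) (hU n)

theorem oneSubRpow_add [CompleteSpace A] (hα : 0 ≤ α) (hβ : 0 ≤ β) (hU : ∀ n, ‖U ^ n‖ ≤ 1) :
    oneSubRpow (α + β) U = oneSubRpow α U * oneSubRpow β U := by
  rw [oneSubRpow, oneSubRpow, oneSubRpow, tsum_mul_tsum_eq_tsum_sum_antidiagonal_of_summable_norm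
    (summable_norm_diffCoeff_smul hα hU) (summable_norm_diffCoeff_smul hβ hU)]
  refine tsum_congr fun n => ?_
  rw [diffCoeff_add, Finset.sum_smul]
  refine Finset.sum_congr rfl fun ij hij => ?_
  rw [smul_mul_smul_comm, ← pow_add, Finset.HasAntidiagonal.mem_antidiagonal.1 hij]

theorem oneSubRpow_zero : oneSubRpow 0 U = 1 := by
  rw [oneSubRpow, tsum_eq_single 0]
  · simp [diffCoeff_zero_right]
  · intro n hn
    obtain ⟨m, rfl⟩ := Nat.exists_eq_succ_of_ne_zero hn
    rw [Nat.succ_eq_add_one, diffCoeff_succ_eq_sum]; simp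

theorem oneSubRpow_one : oneSubRpow 1 U = 1 - U := by
  have h2 : ∀ n, diffCoeff 1 (n + 2) = 0 := by
    intro n
    have h := diffCoeff_add_one 0 (n + 1)
    rw [zero_add] at h
    rw [h, diffCoeff_succ_eq_sum, diffCoeff_succ_eq_sum]; simp
  rw [oneSubRpow, tsum_eq_sum (s := Finset.range 2)]
  · simp [Finset.sum_range_succ, diffCoeff_zero_right, diffCoeff_succ_eq_sum, sub_eq_add_neg]
  · intro n hn
    obtain ⟨m, rfl⟩ := Nat.exists_eq_add_of_le' (by simpa [Nat.lt_iff_add_one_le] using hn : 2 ≤ n)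
    rw [h2, zero_smul]

theorem oneSubRpow_natCast [CompleteSpace A] (r : ℕ) (hU : ∀ n, ‖U ^ n‖ ≤ 1) :
    oneSubRpow r U = (1 - U) ^ r := by
  induction r with
  | zero => simpa using oneSubRpow_zero
  | succ r ih =>
    rw [Nat.cast_succ, oneSubRpow_add r.cast_nonneg zero_le_one hU, ih, oneSubRpow_one, pow_succ]

theorem commute_oneSubRpow [CompleteSpace A] {B : A} (hα : 0 ≤ α) (hU : ∀ n, ‖U ^ n‖ ≤ 1) (h : Commute B U) :
    Commute B (oneSubRpow α U) := by
  have hs := (summable_norm_diffCoeff_smul hα hU).of_norm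
  rw [commute_iff_eq, oneSubRpow, ← hs.tsum_mul_left, ← hs.tsum_mul_right]
  exact tsum_congr fun n => ((h.pow_right n).smul_right _).eq

end Banach

section Operator

variable {E : Type*} [NormedAddCommGroup E] [NormedSpace ℝ E]

theorem sum_rpow_neg_le {β : ℝ} (h0 : 0 ≤ β) (h1 : β < 1) (M : ℕ) :
    ∑ i ∈ Finset.range M, ((i : ℝ) + 1) ^ (-β) ≤ (M : ℝ) ^ (1 - β) / (1 - β) := by
  have hb : 0 < 1 - β := by linarith
  induction M with
  | zero => simp [zero_rpow hb.ne']
  | succ M ih =>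
    have hM : (0 : ℝ) < M + 1 := by positivity
    have hB := rpow_one_add_le_one_add_mul_self (s := -(1 / ((M : ℝ) + 1))) (p := 1 - β)
      (by rw [neg_le_neg_iff, div_le_one hM]; linarith [(M.cast_nonneg : (0 : ℝ) ≤ M)])
      hb.le (by linarith)
    have e1 : (M : ℝ) ^ (1 - β) =
        ((M : ℝ) + 1) ^ (1 - β) * (1 + -(1 / ((M : ℝ) + 1))) ^ (1 - β) := by
      have : 1 + -(1 / ((M : ℝ) + 1)) = M / (M + 1) := by field_simp; ring
      rw [this, ← mul_rpow hM.le (by positivity)]; congr 1; field_simp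
    have e2 : ((M : ℝ) + 1) ^ (-β) = ((M : ℝ) + 1) ^ (1 - β) / (M + 1) := by
      rw [sub_eq_add_neg, rpow_add hM, rpow_one]; field_simp
    have hle : (M : ℝ) ^ (1 - β) ≤ ((M : ℝ) + 1) ^ (1 - β) - (1 - β) * ((M : ℝ) + 1) ^ (-β) := by
      rw [e2]
      calc _ = _ := e1
        _ ≤ ((M : ℝ) + 1) ^ (1 - β) * (1 + (1 - β) * -(1 / ((M : ℝ) + 1))) := by gcongr
        _ = _ := by ring
    rw [Finset.sum_range_succ, Nat.cast_succ]
    calc _ ≤ (M : ℝ) ^ (1 - β) / (1 - β) + ((M : ℝ) + 1) ^ (-β) := by gcongr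
      _ ≤ (((M : ℝ) + 1) ^ (1 - β) - (1 - β) * ((M : ℝ) + 1) ^ (-β)) / (1 - β)
          + ((M : ℝ) + 1) ^ (-β) := by gcongr
      _ = _ := by field_simp; ring

theorem sum_diffCoeff_smul_pow (β : ℝ) (U : E →L[ℝ] E) (M : ℕ) :
    ∑ i ∈ Finset.range (M + 1), diffCoeff β i • U ^ i =
      (∑ i ∈ Finset.range M, (∑ j ∈ Finset.range (i + 1), diffCoeff β j) • U ^ i) * (1 - U) +
        (∑ j ∈ Finset.range (M + 1), diffCoeff β j) • U ^ M := by
  induction M with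
  | zero => simp
  | succ M ih =>
    rw [Finset.sum_range_succ, ih, Finset.sum_range_succ (fun j => diffCoeff β j) (M + 1),
      Finset.sum_range_succ (fun i => (∑ j ∈ Finset.range (i + 1), diffCoeff β j) • U ^ i) M, add_mul _ _ (1 - U), add_smul, smul_mul_assoc,
      show U ^ M * (1 - U) = U ^ M - U ^ (M + 1) by rw [mul_sub, mul_one, pow_succ], smul_sub]
    abel

/-- A fractional power of order less than one interpolates between the identity and the first
difference. -/
theorem norm_oneSubRpow_apply_le [CompleteSpace E] {β : ℝ} (h0 : 0 ≤ β) (h1 : β < 1) {U : E →L[ℝ] E}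
    (hU : ∀ n, ‖U ^ n‖ ≤ 1) {M : ℕ} (hM : 1 ≤ M) (g : E) :
    ‖oneSubRpow β U g‖ ≤
      (M : ℝ) ^ (1 - β) / (1 - β) * ‖(1 - U) g‖ + 2 * (M : ℝ) ^ (-β) * ‖g‖ := by
  have hUg : ∀ n (x : E), ‖(U ^ n) x‖ ≤ ‖x‖ := fun n x =>
    ((U ^ n).le_of_opNorm_le (hU n) x).trans_eq (one_mul _)
  have hS : ∑ i ∈ Finset.range (M + 1), diffCoeff β i ≤ (M : ℝ) ^ (-β) :=
    (sum_diffCoeff_mem h0 h1.le M).2.trans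
      (rpow_le_rpow_of_nonpos (by positivity) (by linarith) (by linarith))
  have hs := (summable_norm_diffCoeff_smul h0 hU).of_norm
  rw [oneSubRpow, ← hs.sum_add_tsum_nat_add (M + 1), sum_diffCoeff_smul_pow]
  simp only [add_apply, ContinuousLinearMap.mul_def, ContinuousLinearMap.comp_apply,
    smul_apply]
  have t1 : ‖(∑ i ∈ Finset.range M, (∑ j ∈ Finset.range (i + 1), diffCoeff β j) • U ^ i)
      ((1 - U) g)‖ ≤ (M : ℝ) ^ (1 - β) / (1 - β) * ‖(1 - U) g‖ := by
    rw [sum_apply]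
    refine (norm_sum_le _ _).trans ?_
    refine le_trans ?_ (mul_le_mul_of_nonneg_right (sum_rpow_neg_le h0 h1 M) (norm_nonneg _))
    rw [Finset.sum_mul]
    refine Finset.sum_le_sum fun i _ => ?_
    rw [smul_apply, norm_smul, norm_eq_abs,
      abs_of_nonneg (sum_diffCoeff_mem h0 h1.le i).1]
    exact mul_le_mul (sum_diffCoeff_mem h0 h1.le i).2 (hUg i _) (norm_nonneg _) (by positivity)
  have t2 : ‖(∑ j ∈ Finset.range (M + 1), diffCoeff β j) • (U ^ M) g‖ ≤ (M : ℝ) ^ (-β) * ‖g‖ := by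
    rw [norm_smul, norm_eq_abs, abs_of_nonneg (sum_diffCoeff_mem h0 h1.le M).1]
    exact mul_le_mul hS (hUg M _) (norm_nonneg _) (by positivity)
  have t3 : ‖(∑' i, diffCoeff β (i + (M + 1)) • U ^ (i + (M + 1))) g‖ ≤ (M : ℝ) ^ (-β) * ‖g‖ := by
    refine ContinuousLinearMap.le_of_opNorm_le _ (le_trans ?_ hS) g
    have hab := (summable_nat_add_iff (M + 1)).2 (summable_abs_diffCoeff h0)
    refine (tsum_of_norm_bounded hab.hasSum fun n => ?_).trans
      (hab.tsum_le_of_sum_range_le (sum_abs_diffCoeff_tail h0 h1.le M))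
    rw [norm_smul, norm_eq_abs]
    exact mul_le_of_le_one_right (abs_nonneg _) (hU _)
  calc _ ≤ _ := (norm_add_le _ _).trans (add_le_add (norm_add_le _ _) le_rfl)
    _ ≤ _ := by linarith

end Operator

/-- Even trigonometric polynomials of degree at most `d`. -/
def cosPoly (d : ℕ) : Submodule ℝ (ℝ → ℝ) :=
  Submodule.span ℝ ((fun (j : ℕ) (t : ℝ) => cos (j * t)) '' Set.Iic d)

theorem cos_mem_cosPoly {j d : ℕ} (h : j ≤ d) : (fun t : ℝ => cos (j * t)) ∈ cosPoly d :=
  Submodule.subset_span ⟨j, h, rfl⟩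

theorem const_mem_cosPoly (d : ℕ) (c : ℝ) : (fun _ : ℝ => c) ∈ cosPoly d := by
  have := (cosPoly d).smul_mem c (cos_mem_cosPoly (Nat.zero_le d))
  convert this using 1
  ext t; simp

theorem cosPoly_mono {d e : ℕ} (h : d ≤ e) : cosPoly d ≤ cosPoly e :=
  Submodule.span_mono (Set.image_mono (Set.Iic_subset_Iic.2 h))

theorem exists_coeff_of_mem_cosPoly {d : ℕ} {K : ℝ → ℝ} (hK : K ∈ cosPoly d) :
    ∃ a : ℕ → ℝ, ∀ t, K t = ∑ j ∈ Finset.range (d + 1), a j * cos (j * t) := by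
  induction hK using Submodule.span_induction with
  | mem x hx =>
    obtain ⟨j, hj, rfl⟩ := hx
    refine ⟨Pi.single j 1, fun t => ?_⟩
    rw [Finset.sum_eq_single j]
    · simp
    · intro i _ hij; simp [hij]
    · intro h; exact absurd (Finset.mem_range.2 (Nat.lt_succ_of_le hj)) h
  | zero => exact ⟨0, by simp⟩
  | add x y _ _ hx hy =>
    obtain ⟨a, ha⟩ := hx
    obtain ⟨b, hb⟩ := hy
    exact ⟨a + b, fun t => by simp [ha, hb, add_mul, Finset.sum_add_distrib]⟩
  | smul c x _ hx =>
    obtain ⟨a, ha⟩ := hx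
    exact ⟨c • a, fun t => by simp [ha, Finset.mul_sum, mul_assoc]⟩

theorem mul_mem_cosPoly {d e : ℕ} {K L : ℝ → ℝ} (hK : K ∈ cosPoly d) (hL : L ∈ cosPoly e) :
    (fun t => K t * L t) ∈ cosPoly (d + e) := by
  have base : ∀ i j : ℕ, i ≤ j → i ≤ d + e → j ≤ d + e → i + j ≤ d + e →
      (fun t : ℝ => cos (i * t) * cos (j * t)) ∈ cosPoly (d + e) := by
    intro i j hij _ _ h
    have h1 := cos_mem_cosPoly (j := j - i) (d := d + e) (by omega)
    have h2 := cos_mem_cosPoly h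
    have h3 := (cosPoly (d + e)).smul_mem (1 / 2) ((cosPoly (d + e)).add_mem h1 h2)
    convert h3 using 1
    ext t
    simp only [Pi.smul_apply, Pi.add_apply, smul_eq_mul, Nat.cast_sub hij, Nat.cast_add, sub_mul,
      add_mul, cos_sub, cos_add]
    ring
  induction hK using Submodule.span_induction with
  | mem x hx =>
    obtain ⟨i, hi, rfl⟩ := hx
    have hi' : i ≤ d := hi
    induction hL using Submodule.span_induction with
    | mem y hy =>
      obtain ⟨j, hj, rfl⟩ := hy
      have hj' : j ≤ e := hj
      rcases le_total i j with h | h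
      · exact base i j h (by omega) (by omega) (by omega)
      · simpa only [mul_comm] using base j i h (by omega) (by omega) (by omega)
    | zero => convert (cosPoly (d + e)).zero_mem using 1; ext t; simp
    | add y z _ _ hy hz =>
      convert (cosPoly (d + e)).add_mem hy hz using 1
      ext t; simp [mul_add]
    | smul c y _ hy =>
      convert (cosPoly (d + e)).smul_mem c hy using 1
      ext t; simp [mul_left_comm]
  | zero => convert (cosPoly (d + e)).zero_mem using 1; ext t; simp
  | add y z _ _ hy hz =>
    convert (cosPoly (d + e)).add_mem hy hz using 1
    ext t; simp [add_mul]
  | smul c y _ hy =>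
    convert (cosPoly (d + e)).smul_mem c hy using 1
    ext t; simp [mul_assoc]

theorem pow_mem_cosPoly {d : ℕ} {K : ℝ → ℝ} (hK : K ∈ cosPoly d) (s : ℕ) :
    (fun t => K t ^ s) ∈ cosPoly (s * d) := by
  induction s with
  | zero => simpa using const_mem_cosPoly 0 1
  | succ s ih => simpa only [pow_succ, add_mul, one_mul] using mul_mem_cosPoly ih hK

theorem integral_cos_intCast_mul_add (k : ℤ) (c : ℝ) :
    ∫ t in -π..π, cos (k * t + c) = if k = 0 then 2 * π * cos c else 0 := by
  split_ifs with hk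
  · simp only [hk, Int.cast_zero, zero_mul, zero_add, intervalIntegral.integral_const, smul_eq_mul]
    ring
  · have hk' : (k : ℝ) ≠ 0 := Int.cast_ne_zero.2 hk
    rw [intervalIntegral.integral_comp_mul_add (fun x => cos x) hk', integral_cos]
    have : (k : ℝ) * π + c = (k : ℝ) * -π + c + k * (2 * π) := by ring
    rw [this, sin_add_int_mul_two_pi, sub_self, smul_zero]

theorem integral_cos_mul_cos (i j : ℕ) :
    ∫ t in -π..π, cos (i * t) * cos (j * t) =
      (if i = j then π else 0) + if i = 0 ∧ j = 0 then π else 0 := by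
  have h : ∀ t : ℝ, cos (i * t) * cos (j * t) =
      1 / 2 * cos (((i - j : ℤ) : ℝ) * t + 0) + 1 / 2 * cos (((i + j : ℤ) : ℝ) * t + 0) := by
    intro t; push_cast; simp only [sub_mul, add_mul, add_zero, cos_sub, cos_add]; ring
  simp only [h]
  rw [intervalIntegral.integral_add (by apply Continuous.intervalIntegrable; fun_prop)
    (by apply Continuous.intervalIntegrable; fun_prop), intervalIntegral.integral_const_mul,
    intervalIntegral.integral_const_mul, integral_cos_intCast_mul_add, integral_cos_intCast_mul_add]
  have e1 : ((i : ℤ) - j = 0) ↔ i = j := by omega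
  have e2 : ((i : ℤ) + j = 0) ↔ (i = 0 ∧ j = 0) := by omega
  simp only [e1, e2, cos_zero]
  split_ifs <;> ring

theorem integral_cos_mul_sin (i j : ℕ) : ∫ t in -π..π, cos (i * t) * sin (j * t) = 0 := by
  have h := intervalIntegral.integral_comp_neg (a := -π) (b := π)
    (fun t : ℝ => cos (i * t) * sin (j * t))
  simp only [mul_neg, cos_neg, sin_neg, neg_neg, intervalIntegral.integral_neg] at h
  linarith

/-- The Dirichlet kernel. -/
def dirichletKernel (n : ℕ) (t : ℝ) : ℝ := 1 + 2 * ∑ j ∈ Finset.range n, cos ((j + 1 : ℕ) * t)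

/-- The squared modulus of `∑_{j < n} e^{ijt}`, an unnormalized Fejér kernel. -/
def fejerSum (n : ℕ) (t : ℝ) : ℝ :=
  (∑ j ∈ Finset.range n, cos (j * t)) ^ 2 + (∑ j ∈ Finset.range n, sin (j * t)) ^ 2

@[fun_prop]
theorem continuous_dirichletKernel (n : ℕ) : Continuous (dirichletKernel n) := by
  unfold dirichletKernel; fun_prop

@[fun_prop]
theorem continuous_fejerSum (n : ℕ) : Continuous (fejerSum n) := by
  unfold fejerSum; fun_prop

theorem fejerSum_nonneg (n : ℕ) (t : ℝ) : 0 ≤ fejerSum n t := by unfold fejerSum; positivity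

theorem fejerSum_succ (n : ℕ) (t : ℝ) : fejerSum (n + 1) t = fejerSum n t + dirichletKernel n t := by
  have h : ∑ j ∈ Finset.range n, cos ((j + 1 : ℕ) * t) =
      (∑ j ∈ Finset.range n, cos (j * t)) * cos (n * t) +
        (∑ j ∈ Finset.range n, sin (j * t)) * sin (n * t) := by
    rw [← Finset.sum_range_reflect, Finset.sum_mul, Finset.sum_mul, ← Finset.sum_add_distrib]
    refine Finset.sum_congr rfl fun j hj => ?_
    have hj := Finset.mem_range.1 hj
    rw [show n - 1 - j + 1 = n - j by omega, Nat.cast_sub hj.le, sub_mul, cos_sub]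
    ring
  rw [dirichletKernel, h, fejerSum, fejerSum, Finset.sum_range_succ, Finset.sum_range_succ]
  linear_combination sin_sq_add_cos_sq (n * t)

theorem fejerSum_eq_sum (n : ℕ) (t : ℝ) :
    fejerSum n t = ∑ k ∈ Finset.range n, dirichletKernel k t := by
  induction n with
  | zero => simp [fejerSum]
  | succ n ih => rw [fejerSum_succ, ih, Finset.sum_range_succ]

theorem dirichletKernel_mem_cosPoly {n d : ℕ} (h : n ≤ d) : dirichletKernel n ∈ cosPoly d := by
  have h1 : (fun t : ℝ => ∑ j ∈ Finset.range n, cos ((j + 1 : ℕ) * t)) ∈ cosPoly d := by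
    have := (cosPoly d).sum_mem (t := Finset.range n) (f := fun j t => cos ((j + 1 : ℕ) * t))
      fun j hj => cos_mem_cosPoly (by have := Finset.mem_range.1 hj; omega)
    convert this using 1
    ext t; simp
  have := (cosPoly d).add_mem (const_mem_cosPoly d 1) ((cosPoly d).smul_mem (2 : ℝ) h1)
  convert this using 1
  ext t; simp [dirichletKernel]

theorem fejerSum_mem_cosPoly {n d : ℕ} (h : n ≤ d + 1) : fejerSum n ∈ cosPoly d := by
  have : fejerSum n = ∑ k ∈ Finset.range n, dirichletKernel k := by
    ext t; rw [fejerSum_eq_sum, Finset.sum_apply]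
  rw [this]
  exact (cosPoly d).sum_mem fun k hk =>
    dirichletKernel_mem_cosPoly (by have := Finset.mem_range.1 hk; omega)

theorem integral_dirichletKernel_mul_cos {n j : ℕ} (h : j ≤ n) :
    ∫ t in -π..π, dirichletKernel n t * cos (j * t) = 2 * π := by
  have e : ∀ t, dirichletKernel n t * cos (j * t) = cos ((0 : ℕ) * t) * cos (j * t) +
      2 * ∑ i ∈ Finset.range n, cos ((i + 1 : ℕ) * t) * cos (j * t) := by
    intro t; simp [dirichletKernel, Finset.sum_mul, Finset.mul_sum, add_mul, mul_assoc]
  simp only [e]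
  rw [intervalIntegral.integral_add (by apply Continuous.intervalIntegrable; fun_prop)
    (by apply Continuous.intervalIntegrable; fun_prop), intervalIntegral.integral_const_mul,
    intervalIntegral.integral_finsetSum fun _ _ => by
      apply Continuous.intervalIntegrable; fun_prop]
  simp only [integral_cos_mul_cos]
  rcases Nat.eq_zero_or_pos j with rfl | hj
  · simp; ring
  · rw [Finset.sum_eq_single (j - 1)]
    · have : j ≠ 0 := by omega
      simp [Nat.sub_add_cancel hj, this, this.symm]
    · intro i _ hi
      rw [if_neg (by omega), if_neg (by omega), add_zero]
    · intro hn; exact absurd (Finset.mem_range.2 (by omega)) hn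

theorem integral_mul_sin_of_mem_cosPoly {d : ℕ} {K : ℝ → ℝ} (hK : K ∈ cosPoly d) (j : ℕ) :
    ∫ t in -π..π, K t * sin (j * t) = 0 := by
  obtain ⟨a, ha⟩ := exists_coeff_of_mem_cosPoly hK
  simp only [ha, Finset.sum_mul, mul_assoc]
  rw [intervalIntegral.integral_finsetSum fun _ _ => by
      apply Continuous.intervalIntegrable; fun_prop]
  simp [intervalIntegral.integral_const_mul, integral_cos_mul_sin]

theorem integral_fejerSum (n : ℕ) : ∫ t in -π..π, fejerSum n t = 2 * π * n := by
  simp only [fejerSum_eq_sum]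
  rw [intervalIntegral.integral_finsetSum fun _ _ => by
      apply Continuous.intervalIntegrable; fun_prop]
  have : ∀ k, ∫ t in -π..π, dirichletKernel k t = 2 * π := fun k => by
    simpa using integral_dirichletKernel_mul_cos (Nat.zero_le k)
  simp [this]; ring

theorem periodic_fejerSum (n : ℕ) : Function.Periodic (fejerSum n) (2 * π) := by
  intro t
  simp only [fejerSum, mul_add, cos_add_nat_mul_two_pi, sin_add_nat_mul_two_pi]

theorem integral_fejerSum_sub (n : ℕ) (h : ℝ) :
    ∫ t in -π..π, fejerSum n (t - h) = 2 * π * n := by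
  rw [intervalIntegral.integral_comp_sub_right]
  have := (periodic_fejerSum n).intervalIntegral_add_eq (-π - h) (-π)
  rw [show -π - h + 2 * π = π - h by ring, show -π + 2 * π = π by ring] at this
  rw [this, integral_fejerSum]

theorem integral_abs_fejerSum_sub_le (n : ℕ) (h : ℝ) :
    ∫ t in -π..π, |fejerSum n t - fejerSum n (t - h)| ≤ 5 * π * n ^ 2 * |h| := by
  rcases eq_or_ne (n * |h|) 0 with hz | hz
  · rcases mul_eq_zero.1 hz with hn | hh
    · have : n = 0 := by exact_mod_cast hn
      subst this; simp [fejerSum]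
    · rw [abs_eq_zero] at hh; simp [hh]
  have hn : 0 < (n : ℝ) := lt_of_le_of_ne n.cast_nonneg (Ne.symm (left_ne_zero_of_mul hz))
  have hh : 0 < |h| := lt_of_le_of_ne (abs_nonneg _) (Ne.symm (right_ne_zero_of_mul hz))
  set l : ℝ := n * |h| with hl
  have hlpos : 0 < l := by positivity
  set X : ℝ → ℝ := fun t => ∑ i ∈ Finset.range n, ∑ j ∈ Finset.range n,
    cos (((i - j : ℤ) : ℝ) * t + j * h) with hX
  have hXc : Continuous X := by rw [hX]; fun_prop
  have hXeq : ∀ t, X t = (∑ i ∈ Finset.range n, cos (i * t)) *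
      (∑ j ∈ Finset.range n, cos (j * (t - h))) + (∑ i ∈ Finset.range n, sin (i * t)) *
      (∑ j ∈ Finset.range n, sin (j * (t - h))) := by
    intro t
    rw [Finset.sum_mul_sum, Finset.sum_mul_sum, ← Finset.sum_add_distrib]
    refine Finset.sum_congr rfl fun i _ => ?_
    rw [← Finset.sum_add_distrib]
    refine Finset.sum_congr rfl fun j _ => ?_
    rw [← cos_sub]; congr 1; push_cast; ring
  have hpt : ∀ t, |fejerSum n t - fejerSum n (t - h)| ≤
      (1 / (2 * l)) * (fejerSum n t + fejerSum n (t - h) - 2 * X t) +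
        l * (fejerSum n t + fejerSum n (t - h)) := by
    intro t
    rw [hXeq]
    simp only [fejerSum]
    generalize (∑ i ∈ Finset.range n, cos (i * t)) = a
    generalize (∑ i ∈ Finset.range n, sin (i * t)) = b
    generalize (∑ i ∈ Finset.range n, cos (i * (t - h))) = c
    generalize (∑ i ∈ Finset.range n, sin (i * (t - h))) = d
    have key : ∀ u v : ℝ, u * v ≤ (1 / (2 * l)) * u ^ 2 + l / 2 * v ^ 2 := by
      intro u v
      have : (1 / (2 * l)) * u ^ 2 + l / 2 * v ^ 2 - u * v = (u - l * v) ^ 2 / (2 * l) := by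
        field_simp; ring
      have : 0 ≤ (u - l * v) ^ 2 / (2 * l) := by positivity
      linarith
    have k1 := key (a - c) (a + c)
    have k2 := key (b - d) (b + d)
    have k3 := key (c - a) (a + c)
    have k4 := key (d - b) (b + d)
    have l1 : 0 ≤ l / 2 * (a - c) ^ 2 := by positivity
    have l2 : 0 ≤ l / 2 * (b - d) ^ 2 := by positivity
    rw [abs_le]
    constructor <;> nlinarith
  have hXint : 2 * π * n - ∫ t in -π..π, X t ≤ π * n ^ 3 * h ^ 2 := by
    have hx : ∫ t in -π..π, X t = ∑ j ∈ Finset.range n, 2 * π * cos (j * h) := by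
      rw [hX, intervalIntegral.integral_finsetSum fun _ _ => by
        apply Continuous.intervalIntegrable; fun_prop]
      refine Finset.sum_congr rfl fun i hi => ?_
      rw [intervalIntegral.integral_finsetSum fun _ _ => by
        apply Continuous.intervalIntegrable; fun_prop]
      simp only [integral_cos_intCast_mul_add]
      rw [Finset.sum_eq_single i]
      · simp
      · intro j _ hj; rw [if_neg (by omega)]
      · intro hn; exact absurd hi hn
    have hb : ∀ j ∈ Finset.range n, 2 * π * (1 - cos (j * h)) ≤ π * n ^ 2 * h ^ 2 := by
      intro j hj
      have hj : (j : ℝ) ≤ n := by exact_mod_cast (Finset.mem_range.1 hj).le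
      have h1 := one_sub_sq_div_two_le_cos (x := j * h)
      have h2 : ((j : ℝ) * h) ^ 2 ≤ n ^ 2 * h ^ 2 := by rw [mul_pow]; gcongr
      nlinarith [pi_pos]
    have := Finset.sum_le_sum hb
    rw [hx]
    simp only [mul_sub, mul_one, Finset.sum_sub_distrib, Finset.sum_const, Finset.card_range,
      nsmul_eq_mul] at this
    linarith
  have hci : ∀ F : ℝ → ℝ, Continuous F → IntervalIntegrable F volume (-π) π :=
    fun F hF => hF.intervalIntegrable _ _
  calc _ ≤ ∫ t in -π..π, ((1 / (2 * l)) * (fejerSum n t + fejerSum n (t - h) - 2 * X t) +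
        l * (fejerSum n t + fejerSum n (t - h))) :=
        intervalIntegral.integral_mono_on (by linarith [pi_pos]) (hci _ (by fun_prop))
          (hci _ (by fun_prop)) fun t _ => hpt t
    _ = (1 / (2 * l)) * (2 * (2 * π * n - ∫ t in -π..π, X t)) + l * (4 * π * n) := by
        rw [intervalIntegral.integral_add (hci _ (by fun_prop)) (hci _ (by fun_prop)),
          intervalIntegral.integral_const_mul, intervalIntegral.integral_const_mul,
          intervalIntegral.integral_sub (hci _ (by fun_prop)) (hci _ (by fun_prop)),
          intervalIntegral.integral_add (hci _ (by fun_prop)) (hci _ (by fun_prop)),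
          intervalIntegral.integral_const_mul, integral_fejerSum, integral_fejerSum_sub]
        ring
    _ ≤ (1 / (2 * l)) * (2 * (π * n ^ 3 * h ^ 2)) + l * (4 * π * n) := by gcongr
    _ = _ := by
        rw [hl, ← sq_abs h]; field_simp; ring

/-- The de la Vallée Poussin kernel, normalized so that it reproduces trigonometric polynomials of
degree at most `n`. -/
def valleeKernel (n : ℕ) (t : ℝ) : ℝ :=
  (2 * π * (n + 1))⁻¹ * (fejerSum (2 * n + 1) t - fejerSum n t)

@[fun_prop]
theorem continuous_valleeKernel (n : ℕ) : Continuous (valleeKernel n) := by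
  unfold valleeKernel; fun_prop

theorem valleeKernel_mem_cosPoly (n : ℕ) : valleeKernel n ∈ cosPoly (2 * n) := by
  have := (cosPoly (2 * n)).smul_mem (2 * π * (n + 1))⁻¹ ((cosPoly (2 * n)).sub_mem
    (fejerSum_mem_cosPoly (n := 2 * n + 1) le_rfl) (fejerSum_mem_cosPoly (n := n) (by omega)))
  exact this

theorem integral_valleeKernel_mul_cos {n j : ℕ} (h : j ≤ n) :
    ∫ t in -π..π, valleeKernel n t * cos (j * t) = 1 := by
  have e : ∀ t, valleeKernel n t * cos (j * t) = (2 * π * (n + 1))⁻¹ *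
      ∑ k ∈ Finset.range (n + 1), dirichletKernel (n + k) t * cos (j * t) := by
    intro t
    rw [valleeKernel, fejerSum_eq_sum, fejerSum_eq_sum, show 2 * n + 1 = n + (n + 1) by ring,
      Finset.sum_range_add, add_sub_cancel_left, mul_assoc, Finset.sum_mul]
  simp only [e]
  rw [intervalIntegral.integral_const_mul, intervalIntegral.integral_finsetSum fun _ _ => by
    apply Continuous.intervalIntegrable; fun_prop]
  rw [Finset.sum_congr rfl fun k _ => integral_dirichletKernel_mul_cos (n := n + k) (by omega)]
  simp
  have := pi_pos
  field_simp

theorem integral_abs_valleeKernel_le (n : ℕ) : ∫ t in -π..π, |valleeKernel n t| ≤ 3 := by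
  have hpt : ∀ t, |valleeKernel n t| ≤
      (2 * π * (n + 1))⁻¹ * (fejerSum (2 * n + 1) t + fejerSum n t) := by
    intro t
    have hc : 0 ≤ (2 * π * ((n : ℝ) + 1))⁻¹ := by positivity
    rw [valleeKernel, abs_mul, abs_of_nonneg hc]
    gcongr
    have h1 := fejerSum_nonneg (2 * n + 1) t
    have h2 := fejerSum_nonneg n t
    rw [abs_le]; constructor <;> linarith
  have hci : ∀ F : ℝ → ℝ, Continuous F → IntervalIntegrable F volume (-π) π :=
    fun F hF => hF.intervalIntegrable _ _
  refine (intervalIntegral.integral_mono_on (by linarith [pi_pos]) (hci _ (by fun_prop))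
          (hci _ (by fun_prop)) fun t _ => hpt t).trans ?_
  rw [intervalIntegral.integral_const_mul,
    intervalIntegral.integral_add (hci _ (by fun_prop)) (hci _ (by fun_prop)),
    integral_fejerSum, integral_fejerSum]
  have := pi_pos
  push_cast
  rw [inv_mul_le_iff₀ (by positivity)]
  nlinarith [mul_nonneg this.le (n.cast_nonneg : (0 : ℝ) ≤ n)]

theorem integral_abs_valleeKernel_sub_le (n : ℕ) (h : ℝ) :
    ∫ t in -π..π, |valleeKernel n t - valleeKernel n (t - h)| ≤ 13 * (n + 1) * |h| := by
  have hpt : ∀ t, |valleeKernel n t - valleeKernel n (t - h)| ≤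
      (2 * π * (n + 1))⁻¹ * (|fejerSum (2 * n + 1) t - fejerSum (2 * n + 1) (t - h)| +
        |fejerSum n t - fejerSum n (t - h)|) := by
    intro t
    have hc : 0 ≤ (2 * π * ((n : ℝ) + 1))⁻¹ := by positivity
    rw [valleeKernel, valleeKernel, ← mul_sub, abs_mul, abs_of_nonneg hc, sub_sub_sub_comm]
    gcongr
    exact abs_sub _ _
  have hci : ∀ F : ℝ → ℝ, Continuous F → IntervalIntegrable F volume (-π) π :=
    fun F hF => hF.intervalIntegrable _ _
  refine (intervalIntegral.integral_mono_on (by linarith [pi_pos]) (hci _ (by fun_prop))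
          (hci _ (by fun_prop)) fun t _ => hpt t).trans ?_
  rw [intervalIntegral.integral_const_mul,
    intervalIntegral.integral_add (hci _ (by fun_prop)) (hci _ (by fun_prop))]
  have h1 := integral_abs_fejerSum_sub_le (2 * n + 1) h
  have h2 := integral_abs_fejerSum_sub_le n h
  have := pi_pos
  rw [inv_mul_le_iff₀ (by positivity)]
  refine (add_le_add h1 h2).trans ?_
  push_cast
  have hn : (0 : ℝ) ≤ n := n.cast_nonneg
  have : 5 * π * (2 * (n : ℝ) + 1) ^ 2 * |h| + 5 * π * n ^ 2 * |h| =
    π * |h| * (5 * (2 * (n : ℝ) + 1) ^ 2 + 5 * n ^ 2) := by ring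
  rw [this, show 2 * π * ((n : ℝ) + 1) * (13 * (n + 1) * |h|) =
    π * |h| * (26 * ((n : ℝ) + 1) ^ 2) by ring]
  gcongr
  nlinarith

theorem dirichletKernel_mul (n : ℕ) (t : ℝ) :
    dirichletKernel n t * (2 - 2 * cos t) = 2 * cos (n * t) - 2 * cos ((n + 1 : ℕ) * t) := by
  induction n with
  | zero => simp [dirichletKernel]
  | succ n ih =>
    have : dirichletKernel (n + 1) t = dirichletKernel n t + 2 * cos ((n + 1 : ℕ) * t) := by
      simp only [dirichletKernel, Finset.sum_range_succ]; ring
    rw [this, add_mul, ih]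
    have e1 : ((n + 1 + 1 : ℕ) : ℝ) * t = (n + 1 : ℕ) * t + t := by push_cast; ring
    have e2 : (n : ℝ) * t = (n + 1 : ℕ) * t - t := by push_cast; ring
    rw [e1, e2, cos_add, cos_sub]; ring

theorem fejerSum_mul (n : ℕ) (t : ℝ) :
    fejerSum n t * (2 - 2 * cos t) = 2 - 2 * cos (n * t) := by
  induction n with
  | zero => simp [fejerSum]
  | succ n ih => rw [fejerSum_succ, add_mul, ih, dirichletKernel_mul]; ring

theorem fejerSum_le_sq (n : ℕ) (t : ℝ) : fejerSum n t ≤ n ^ 2 := by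
  induction n with
  | zero => simp [fejerSum]
  | succ n ih =>
    have : ∑ j ∈ Finset.range n, cos ((j + 1 : ℕ) * t) ≤ n :=
      (Finset.sum_le_sum fun j _ => cos_le_one _).trans (by simp)
    rw [fejerSum_succ, dirichletKernel]; push_cast at this ⊢; nlinarith

theorem sq_mul_fejerSum_le (n : ℕ) {t : ℝ} (ht : |t| ≤ π) : t ^ 2 * fejerSum n t ≤ π ^ 2 := by
  have h1 := cos_le_one_sub_mul_cos_sq ht
  have h2 := fejerSum_mul n t
  have h3 := neg_one_le_cos (n * t)
  have h4 := mul_le_mul_of_nonneg_left h1 (fejerSum_nonneg n t)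
  have h5 : fejerSum n t * (4 / π ^ 2 * t ^ 2) ≤ 4 := by
    linear_combination 2 * h4 + h2 + 2 * h3
  have h6 := mul_le_mul_of_nonneg_left h5 (by positivity : (0 : ℝ) ≤ π ^ 2 / 4)
  calc t ^ 2 * fejerSum n t = π ^ 2 / 4 * (fejerSum n t * (4 / π ^ 2 * t ^ 2)) := by
        field_simp
    _ ≤ _ := by linarith

theorem fejerSum_weight_le (n s : ℕ) {t : ℝ} (ht : |t| ≤ π) :
    fejerSum n t ^ (s + 1) * (1 + n * |t|) ^ (2 * s) ≤
      (2 * (1 + π ^ 2) * n ^ 2) ^ s * fejerSum n t := by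
  have h0 := fejerSum_nonneg n t
  have h : fejerSum n t * (1 + n * |t|) ^ 2 ≤ 2 * (1 + π ^ 2) * n ^ 2 := by
    have h1 := sq_mul_fejerSum_le n ht
    have h2 := fejerSum_le_sq n t
    have h3 : (1 + n * |t|) ^ 2 ≤ 2 * (1 + n ^ 2 * t ^ 2) := by
      rw [← sq_abs t]; nlinarith [sq_nonneg (1 - n * |t|)]
    calc _ ≤ fejerSum n t * (2 * (1 + n ^ 2 * t ^ 2)) := by gcongr
      _ = 2 * (fejerSum n t + n ^ 2 * (t ^ 2 * fejerSum n t)) := by ring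
      _ ≤ 2 * (n ^ 2 + n ^ 2 * π ^ 2) := by gcongr
      _ = _ := by ring
  calc _ = (fejerSum n t * (1 + n * |t|) ^ 2) ^ s * fejerSum n t := by
        rw [mul_pow, ← pow_mul, pow_succ]; ring
    _ ≤ _ := by gcongr

theorem integral_fejerSum_pow_ge {n : ℕ} (hn : 1 ≤ n) (s : ℕ) :
    (n : ℝ)⁻¹ * (n ^ 2 / 4) ^ (s + 1) ≤ ∫ t in -π..π, fejerSum n t ^ (s + 1) := by
  have hn' : (1 : ℝ) ≤ n := by exact_mod_cast hn
  have hinv : (n : ℝ)⁻¹ ≤ 1 := inv_le_one_of_one_le₀ hn'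
  have hinv0 : 0 ≤ (n : ℝ)⁻¹ := by positivity
  have hpt : ∀ t ∈ Set.Icc 0 (n : ℝ)⁻¹, ((n : ℝ) ^ 2 / 4) ^ (s + 1) ≤ fejerSum n t ^ (s + 1) := by
    intro t ht
    gcongr
    have : (n : ℝ) * (1 / 2) ≤ ∑ j ∈ Finset.range n, cos (j * t) := by
      have : ∑ j ∈ Finset.range n, (1 / 2 : ℝ) ≤ ∑ j ∈ Finset.range n, cos (j * t) := by
        refine Finset.sum_le_sum fun j hj => ?_
        have hj : (j : ℝ) ≤ n := by exact_mod_cast (Finset.mem_range.1 hj).le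
        have hjt : (j : ℝ) * t ≤ 1 := by
          calc (j : ℝ) * t ≤ n * (n : ℝ)⁻¹ := mul_le_mul hj ht.2 ht.1 (by positivity)
            _ = 1 := by field_simp
        have hjt0 : 0 ≤ (j : ℝ) * t := mul_nonneg j.cast_nonneg ht.1
        have := one_sub_sq_div_two_le_cos (x := j * t)
        nlinarith
      simpa using this
    rw [fejerSum]
    nlinarith [sq_nonneg (∑ j ∈ Finset.range n, sin (j * t))]
  have hc : Continuous fun t => fejerSum n t ^ (s + 1) := by fun_prop
  calc _ = ∫ t in (0 : ℝ)..(n : ℝ)⁻¹, ((n : ℝ) ^ 2 / 4) ^ (s + 1) := by simp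
    _ ≤ ∫ t in (0 : ℝ)..(n : ℝ)⁻¹, fejerSum n t ^ (s + 1) :=
        intervalIntegral.integral_mono_on hinv0 (by simp) (hc.intervalIntegrable _ _) hpt
    _ ≤ _ := intervalIntegral.integral_mono_interval (by linarith [pi_pos]) hinv0
        (by linarith [pi_gt_three])
        (Filter.Eventually.of_forall fun t => pow_nonneg (fejerSum_nonneg n t) _)
        (hc.intervalIntegrable _ _)

/-- The generalized Jackson kernel. -/
def jacksonKernel (s n : ℕ) (t : ℝ) : ℝ :=
  (∫ u in -π..π, fejerSum n u ^ (s + 1))⁻¹ * fejerSum n t ^ (s + 1)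

@[fun_prop]
theorem continuous_jacksonKernel (s n : ℕ) : Continuous (jacksonKernel s n) := by
  unfold jacksonKernel; fun_prop

theorem integral_fejerSum_pow_pos {n : ℕ} (hn : 1 ≤ n) (s : ℕ) :
    0 < ∫ t in -π..π, fejerSum n t ^ (s + 1) := by
  refine lt_of_lt_of_le ?_ (integral_fejerSum_pow_ge hn s)
  have : (0 : ℝ) < n := by exact_mod_cast hn
  positivity

theorem jacksonKernel_nonneg {n : ℕ} (s : ℕ) (hn : 1 ≤ n) (t : ℝ) : 0 ≤ jacksonKernel s n t :=
  mul_nonneg (inv_nonneg.2 (integral_fejerSum_pow_pos hn s).le) (pow_nonneg (fejerSum_nonneg n t) _)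

theorem integral_jacksonKernel {n : ℕ} (s : ℕ) (hn : 1 ≤ n) :
    ∫ t in -π..π, jacksonKernel s n t = 1 := by
  simp only [jacksonKernel]
  rw [intervalIntegral.integral_const_mul, inv_mul_cancel₀ (integral_fejerSum_pow_pos hn s).ne']

theorem jacksonKernel_mem_cosPoly (s n : ℕ) {d : ℕ} (h : (s + 1) * (n - 1) ≤ d) :
    jacksonKernel s n ∈ cosPoly d :=
  cosPoly_mono h ((cosPoly _).smul_mem _
    (pow_mem_cosPoly (fejerSum_mem_cosPoly (by omega)) (s + 1)))

theorem integral_jacksonKernel_mul_le {n : ℕ} (s : ℕ) (hn : 1 ≤ n) :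
    ∫ t in -π..π, jacksonKernel s n t * (1 + n * |t|) ^ (2 * s) ≤
      (2 * (1 + π ^ 2)) ^ s * (2 * π) * 4 ^ (s + 1) := by
  have hn0 : (0 : ℝ) < n := by exact_mod_cast hn
  have hI := integral_fejerSum_pow_pos hn s
  simp only [jacksonKernel, mul_assoc]
  rw [intervalIntegral.integral_const_mul, inv_mul_le_iff₀ hI]
  have hci : ∀ F : ℝ → ℝ, Continuous F → IntervalIntegrable F volume (-π) π :=
    fun F hF => hF.intervalIntegrable _ _
  calc _ ≤ ∫ t in -π..π, (2 * (1 + π ^ 2) * n ^ 2) ^ s * fejerSum n t :=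
        intervalIntegral.integral_mono_on (by linarith [pi_pos]) (hci _ (by fun_prop))
          (hci _ (by fun_prop)) fun t ht => fejerSum_weight_le n s (abs_le.2 ht)
    _ = (2 * (1 + π ^ 2) * n ^ 2) ^ s * (2 * π * n) := by
        rw [intervalIntegral.integral_const_mul, integral_fejerSum]
    _ = ((n : ℝ)⁻¹ * (n ^ 2 / 4) ^ (s + 1)) * ((2 * (1 + π ^ 2)) ^ s * (2 * π) * 4 ^ (s + 1)) := by
        rw [mul_pow, div_pow, pow_succ ((n : ℝ) ^ 2)]; field_simp
    _ ≤ _ := by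
        simp only [← mul_assoc]
        have := integral_fejerSum_pow_ge hn s
        gcongr

/-- A strongly continuous `2π`-periodic one-parameter group of isometries. -/
structure PeriodicGroup (E : Type*) [NormedAddCommGroup E] [NormedSpace ℝ E] where
  toFun : ℝ → E →L[ℝ] E
  map_zero' : toFun 0 = 1
  map_add' : ∀ s t, toFun (s + t) = toFun s * toFun t
  norm_map' : ∀ t g, ‖toFun t g‖ = ‖g‖
  continuous' : ∀ g, Continuous fun t => toFun t g
  periodic' : Function.Periodic toFun (2 * π)

namespace PeriodicGroup

variable {E : Type*} [NormedAddCommGroup E] [NormedSpace ℝ E]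

instance : CoeFun (PeriodicGroup E) fun _ => ℝ → E →L[ℝ] E := ⟨toFun⟩

variable (T : PeriodicGroup E)

theorem map_zero : T 0 = 1 := T.map_zero'

theorem map_add (s t : ℝ) : T (s + t) = T s * T t := T.map_add' s t

theorem norm_map (t : ℝ) (g : E) : ‖T t g‖ = ‖g‖ := T.norm_map' t g

theorem periodic : Function.Periodic T (2 * π) := T.periodic'

@[fun_prop]
theorem continuous_apply {φ : ℝ → ℝ} (hφ : Continuous φ) (g : E) :
    Continuous fun t => T (φ t) g := (T.continuous' g).comp hφ

theorem commute (s t : ℝ) : Commute (T s) (T t) := by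
  rw [commute_iff_eq, ← T.map_add, ← T.map_add, add_comm]

theorem map_natCast_mul (n : ℕ) (t : ℝ) : T (n * t) = T t ^ n := by
  induction n with
  | zero => simp [T.map_zero]
  | succ n ih => rw [pow_succ, ← ih, ← T.map_add]; congr 1; push_cast; ring

theorem norm_pow_le (t : ℝ) (n : ℕ) : ‖T t ^ n‖ ≤ 1 := by
  rw [← T.map_natCast_mul]
  exact ContinuousLinearMap.opNorm_le_bound _ zero_le_one fun g => by rw [T.norm_map, one_mul]

/-- The average of a periodic group against a kernel over one period. -/
def conv (K : C(ℝ, ℝ)) : E →L[ℝ] E :=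
  LinearMap.mkContinuous
    { toFun := fun g => ∫ t in -π..π, K t • T t g
      map_add' := fun g g' => by
        simp only [_root_.map_add, smul_add]
        exact intervalIntegral.integral_add (by apply Continuous.intervalIntegrable; fun_prop)
          (by apply Continuous.intervalIntegrable; fun_prop)
      map_smul' := fun c g => by
        simp only [map_smul, RingHom.id_apply]
        rw [← intervalIntegral.integral_smul]
        simp only [smul_comm c] }
    (∫ t in -π..π, |K t|) fun g => by
      rw [← intervalIntegral.integral_mul_const]
      refine intervalIntegral.norm_integral_le_of_norm_le (by linarith [pi_pos])
        (Filter.Eventually.of_forall fun t _ => ?_)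
        (by apply Continuous.intervalIntegrable; fun_prop)
      rw [norm_smul, T.norm_map, norm_eq_abs]

theorem conv_apply (K : C(ℝ, ℝ)) (g : E) : T.conv K g = ∫ t in -π..π, K t • T t g := rfl

theorem norm_integral_smul_le {K : ℝ → ℝ} (hK : Continuous K) (g : E) :
    ‖∫ t in -π..π, K t • T t g‖ ≤ (∫ t in -π..π, |K t|) * ‖g‖ := by
  rw [← intervalIntegral.integral_mul_const]
  refine intervalIntegral.norm_integral_le_of_norm_le (by linarith [pi_pos])
    (Filter.Eventually.of_forall fun t _ => ?_)
    (by apply Continuous.intervalIntegrable; fun_prop)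
  rw [norm_smul, T.norm_map, norm_eq_abs]

theorem norm_conv_apply_le (K : C(ℝ, ℝ)) (g : E) :
    ‖T.conv K g‖ ≤ (∫ t in -π..π, |K t|) * ‖g‖ := T.norm_integral_smul_le K.continuous g

theorem conv_add (K L : C(ℝ, ℝ)) : T.conv (K + L) = T.conv K + T.conv L := by
  ext g
  simp only [conv_apply, add_apply, ContinuousMap.add_apply, add_smul]
  exact intervalIntegral.integral_add (by apply Continuous.intervalIntegrable; fun_prop)
    (by apply Continuous.intervalIntegrable; fun_prop)

theorem conv_smul (c : ℝ) (K : C(ℝ, ℝ)) : T.conv (c • K) = c • T.conv K := by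
  ext g
  simp only [conv_apply, smul_apply, ContinuousMap.smul_apply, smul_assoc]
  exact intervalIntegral.integral_smul _ _

/-- `conv` as a linear map in the kernel. -/
def convₗ : C(ℝ, ℝ) →ₗ[ℝ] E →L[ℝ] E where
  toFun := T.conv
  map_add' := T.conv_add
  map_smul' := T.conv_smul

theorem convₗ_apply (K : C(ℝ, ℝ)) : T.convₗ K = T.conv K := rfl

variable [CompleteSpace E]

theorem commute_conv {B : E →L[ℝ] E} (hB : ∀ t, Commute B (T t)) (K : C(ℝ, ℝ)) :
    Commute B (T.conv K) := by
  ext g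
  simp only [mul_apply_eq_comp, conv_apply]
  rw [← ContinuousLinearMap.intervalIntegral_comp_comm B
    (by apply Continuous.intervalIntegrable; fun_prop)]
  refine intervalIntegral.integral_congr fun t _ => ?_
  simp only [map_smul]
  congr 1
  exact DFunLike.congr_fun (hB t).eq g

theorem commute_conv_apply (K : C(ℝ, ℝ)) (t : ℝ) : Commute (T.conv K) (T t) :=
  (T.commute_conv (T.commute t) K).symm

theorem map_conv_apply {K : C(ℝ, ℝ)} (hK : Function.Periodic K (2 * π)) (s : ℝ) (g : E) :
    T s (T.conv K g) = ∫ t in -π..π, K (t - s) • T t g := by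
  rw [conv_apply, ← ContinuousLinearMap.intervalIntegral_comp_comm (T s)
    (by apply Continuous.intervalIntegrable; fun_prop)]
  have h1 : ∀ t, T s (K t • T t g) = (fun u => K (u - s) • T u g) (t + s) := fun t => by
    simp only [map_smul, add_sub_cancel_right]
    rw [add_comm t s, T.map_add]; rfl
  have h2 : Function.Periodic (fun u => K (u - s) • T u g) (2 * π) := fun u => by
    simp only
    rw [T.periodic, show u + 2 * π - s = u - s + 2 * π by ring, hK]
  simp only [h1]
  rw [intervalIntegral.integral_comp_add_right (fun u => K (u - s) • T u g)]
  have := h2.intervalIntegral_add_eq (-π + s) (-π)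
  rwa [show -π + s + 2 * π = π + s by ring, show -π + 2 * π = π by ring] at this

end PeriodicGroup

/-- The kernel `cos (j t)` as a continuous function. -/
def cosKernel (j : ℕ) : C(ℝ, ℝ) := ⟨fun t => cos (j * t), by fun_prop⟩

@[simp]
theorem cosKernel_apply (j : ℕ) (t : ℝ) : cosKernel j t = cos (j * t) := rfl

/-- The kernel `sin (j t)` as a continuous function. -/
def sinKernel (j : ℕ) : C(ℝ, ℝ) := ⟨fun t => sin (j * t), by fun_prop⟩

@[simp]
theorem sinKernel_apply (j : ℕ) (t : ℝ) : sinKernel j t = sin (j * t) := rfl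

theorem periodic_cosKernel (j : ℕ) : Function.Periodic (cosKernel j) (2 * π) := fun t => by
  simp only [cosKernel_apply, mul_add, cos_add_nat_mul_two_pi]

theorem exists_eq_sum_cosKernel {d : ℕ} {K : C(ℝ, ℝ)} (hK : ⇑K ∈ cosPoly d) :
    ∃ a : ℕ → ℝ, K = ∑ j ∈ Finset.range (d + 1), a j • cosKernel j := by
  obtain ⟨a, ha⟩ := exists_coeff_of_mem_cosPoly hK
  exact ⟨a, by ext t; simp [ha]⟩

/-- The de la Vallée Poussin kernel as a bundled continuous function. -/
def valleeC (n : ℕ) : C(ℝ, ℝ) := ⟨valleeKernel n, continuous_valleeKernel n⟩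

@[simp]
theorem valleeC_apply (n : ℕ) (t : ℝ) : valleeC n t = valleeKernel n t := rfl

theorem periodic_valleeC (n : ℕ) : Function.Periodic (valleeC n) (2 * π) := fun t => by
  simp only [valleeC_apply, valleeKernel, periodic_fejerSum _ t]

namespace PeriodicGroup

variable {E : Type*} [NormedAddCommGroup E] [NormedSpace ℝ E] (T : PeriodicGroup E)

theorem norm_conv_vallee_le (n : ℕ) (g : E) : ‖T.conv (valleeC n) g‖ ≤ 3 * ‖g‖ :=
  (T.norm_conv_apply_le _ _).trans
    (mul_le_mul_of_nonneg_right (integral_abs_valleeKernel_le n) (norm_nonneg g))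

variable [CompleteSpace E]

theorem map_conv_cosKernel (s : ℝ) (j : ℕ) (g : E) : T s (T.conv (cosKernel j) g) =
    cos (j * s) • T.conv (cosKernel j) g + sin (j * s) • T.conv (sinKernel j) g := by
  rw [T.map_conv_apply (periodic_cosKernel j), conv_apply, conv_apply,
    ← intervalIntegral.integral_smul, ← intervalIntegral.integral_smul,
    ← intervalIntegral.integral_add (by apply Continuous.intervalIntegrable; fun_prop)
    (by apply Continuous.intervalIntegrable; fun_prop)]
  refine intervalIntegral.integral_congr fun t _ => ?_
  simp only [cosKernel_apply, sinKernel_apply, mul_sub, cos_sub, ← mul_smul, ← add_smul]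
  ring_nf

theorem conv_vallee_conv_cosKernel {n j : ℕ} (h : j ≤ n) (g : E) :
    T.conv (valleeC n) (T.conv (cosKernel j) g) = T.conv (cosKernel j) g := by
  rw [conv_apply]
  simp only [map_conv_cosKernel, smul_add, ← mul_smul, valleeC_apply]
  rw [intervalIntegral.integral_add (by apply Continuous.intervalIntegrable; fun_prop)
    (by apply Continuous.intervalIntegrable; fun_prop), intervalIntegral.integral_smul_const,
    intervalIntegral.integral_smul_const, integral_valleeKernel_mul_cos h,
    integral_mul_sin_of_mem_cosPoly (valleeKernel_mem_cosPoly n), one_smul, zero_smul, add_zero]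

theorem conv_vallee_conv_of_mem_cosPoly {n d : ℕ} (h : d ≤ n) {K : C(ℝ, ℝ)}
    (hK : ⇑K ∈ cosPoly d) (g : E) : T.conv (valleeC n) (T.conv K g) = T.conv K g := by
  obtain ⟨a, rfl⟩ := exists_eq_sum_cosKernel hK
  simp only [← convₗ_apply, map_sum, map_smul, sum_apply, smul_apply]
  refine Finset.sum_congr rfl fun j hj => ?_
  rw [convₗ_apply, convₗ_apply, T.conv_vallee_conv_cosKernel]
  have := Finset.mem_range.1 hj
  omega

theorem conv_vallee_conv_vallee {n m : ℕ} (h : 2 * m ≤ n) (g : E) :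
    T.conv (valleeC n) (T.conv (valleeC m) g) = T.conv (valleeC m) g :=
  T.conv_vallee_conv_of_mem_cosPoly h (valleeKernel_mem_cosPoly m) g

theorem norm_sub_conv_vallee_le {m n : ℕ} (h : 2 * m ≤ n) (g : E) :
    ‖g - T.conv (valleeC n) g‖ ≤ 4 * ‖g - T.conv (valleeC m) g‖ := by
  have e : g - T.conv (valleeC n) g = (g - T.conv (valleeC m) g) -
      T.conv (valleeC n) (g - T.conv (valleeC m) g) := by
    rw [map_sub, T.conv_vallee_conv_vallee h]; abel
  rw [e]
  refine (norm_sub_le _ _).trans ?_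
  linarith [T.norm_conv_vallee_le n (g - T.conv (valleeC m) g)]

theorem norm_one_sub_apply_le {n : ℕ} {g : E} (hg : T.conv (valleeC n) g = g) (s : ℝ) :
    ‖(1 - T s) g‖ ≤ 13 * (n + 1) * |s| * ‖g‖ := by
  have e : (1 - T s) g = ∫ t in -π..π, (valleeKernel n t - valleeKernel n (t - s)) • T t g := by
    simp only [sub_smul]
    rw [intervalIntegral.integral_sub (by apply Continuous.intervalIntegrable; fun_prop)
      (by apply Continuous.intervalIntegrable; fun_prop)]
    have h1 := T.map_conv_apply (periodic_valleeC n) s g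
    have h2 := T.conv_apply (valleeC n) g
    simp only [valleeC_apply] at h1 h2
    rw [← h1, ← h2, hg]; rfl
  rw [e]
  exact (T.norm_integral_smul_le (by fun_prop) g).trans
    (mul_le_mul_of_nonneg_right (integral_abs_valleeKernel_sub_le n s) (norm_nonneg g))

theorem conv_one_sub_pow_apply {K : C(ℝ, ℝ)} {g : E} (hg : T.conv K g = g) (s : ℝ)
    (r : ℕ) : T.conv K (((1 - T s) ^ r) g) = ((1 - T s) ^ r) g := by
  have h : Commute (T.conv K) ((1 - T s) ^ r) :=
    ((Commute.one_right _).sub_right (T.commute_conv_apply K s)).pow_right r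
  have := DFunLike.congr_fun h.eq g
  simp only [mul_apply_eq_comp] at this
  rw [this, hg]

theorem norm_one_sub_pow_apply_le {n : ℕ} {g : E} (hg : T.conv (valleeC n) g = g) (s : ℝ) (r : ℕ) :
    ‖((1 - T s) ^ r) g‖ ≤ (13 * (n + 1) * |s|) ^ r * ‖g‖ := by
  induction r with
  | zero => simp
  | succ r ih =>
    rw [pow_succ' (1 - T s), mul_apply_eq_comp]
    refine (T.norm_one_sub_apply_le (T.conv_one_sub_pow_apply hg s r) s).trans ?_
    rw [pow_succ' (13 * (n + 1) * |s|) r, mul_assoc (13 * (n + 1) * |s|)]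
    exact mul_le_mul_of_nonneg_left ih (by positivity)

/-- A Bernstein inequality for differences of fractional order. -/
theorem exists_norm_oneSubRpow_apply_le (E : Type*) [NormedAddCommGroup E] [NormedSpace ℝ E]
    [CompleteSpace E] {α : ℝ} (hα : 0 ≤ α) :
    ∃ C : ℝ, 0 ≤ C ∧ ∀ (T : PeriodicGroup E) (n : ℕ) (g : E) (s x : ℝ),
      T.conv (valleeC n) g = g → 0 < x → x ≤ 1 → (n + 1) * |s| ≤ 10 * x →
      ‖oneSubRpow α (T s) g‖ ≤ C * x ^ α * ‖g‖ := by
  set r := ⌊α⌋₊ with hr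
  set β := α - r with hβ
  have hβ0 : 0 ≤ β := sub_nonneg.2 (Nat.floor_le hα)
  have hβ1 : β < 1 := by have := Nat.lt_floor_add_one α; linarith
  refine ⟨2 / (1 - β) * 130 ^ (r + 1) + 2 * 130 ^ r, ?_, ?_⟩
  · have : 0 < 1 - β := by linarith
    positivity
  intro T n g s x hg hx hx1 hs
  have hy : 13 * (n + 1) * |s| ≤ 130 * x := by linarith
  have hy0 : 0 ≤ 13 * (n + 1) * |s| := by positivity
  have hU := T.norm_pow_le s
  have e : oneSubRpow α (T s) g = oneSubRpow β (T s) (((1 - T s) ^ r) g) := by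
    rw [← oneSubRpow_natCast r hU, ← mul_apply_eq_comp,
      ← oneSubRpow_add hβ0 (Nat.cast_nonneg r) hU, hβ, sub_add_cancel]
  set M := ⌈1 / x⌉₊ with hM
  have hMx : 1 / x ≤ M := Nat.le_ceil _
  have h1x : 1 ≤ 1 / x := by rwa [le_div_iff₀ hx, one_mul]
  have hM1 : 1 ≤ M := by
    have : (1 : ℝ) ≤ M := h1x.trans hMx
    exact_mod_cast this
  have hM2 : (M : ℝ) ≤ 2 / x := by
    have := Nat.ceil_lt_add_one (a := 1 / x) (by positivity)
    rw [show 2 / x = 1 / x + 1 / x by ring]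
    linarith
  have hMp : (0 : ℝ) < M := by exact_mod_cast hM1
  have hA : (M : ℝ) ^ (1 - β) ≤ 2 * x ^ (β - 1) := by
    calc (M : ℝ) ^ (1 - β) ≤ (2 / x) ^ (1 - β) := by gcongr
      _ = 2 ^ (1 - β) * x ^ (β - 1) := by
        rw [div_rpow (by norm_num) hx.le, show β - 1 = -(1 - β) by ring, rpow_neg hx.le]; rfl
      _ ≤ 2 * x ^ (β - 1) := by
        gcongr
        calc (2 : ℝ) ^ (1 - β) ≤ 2 ^ (1 : ℝ) := by
              apply rpow_le_rpow_of_exponent_le <;> linarith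
          _ = 2 := rpow_one 2
  have hB : (M : ℝ) ^ (-β) ≤ x ^ β := by
    calc (M : ℝ) ^ (-β) ≤ (1 / x) ^ (-β) :=
          rpow_le_rpow_of_nonpos (by positivity) hMx (by linarith)
      _ = x ^ β := by rw [one_div, inv_rpow hx.le, rpow_neg hx.le, inv_inv]
  have h1 := T.norm_one_sub_pow_apply_le hg s r
  have h2 := T.norm_one_sub_pow_apply_le hg s (r + 1)
  rw [pow_succ' (1 - T s), mul_apply_eq_comp] at h2
  have h1' : ‖((1 - T s) ^ r) g‖ ≤ (130 * x) ^ r * ‖g‖ := h1.trans (by gcongr)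
  have h2' : ‖(1 - T s) (((1 - T s) ^ r) g)‖ ≤ (130 * x) ^ (r + 1) * ‖g‖ := h2.trans (by gcongr)
  have h1β : 0 < 1 - β := by linarith
  rw [e]
  refine (norm_oneSubRpow_apply_le hβ0 hβ1 hU hM1 _).trans ?_
  have eα : x ^ α = x ^ β * x ^ r := by
    rw [← rpow_natCast, ← rpow_add hx, hβ, sub_add_cancel]
  have eβ : x ^ β = x ^ (β - 1) * x := by
    rw [← rpow_add_one hx.ne', sub_add_cancel]
  calc _ ≤ 2 * x ^ (β - 1) / (1 - β) * ((130 * x) ^ (r + 1) * ‖g‖) +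
        2 * x ^ β * ((130 * x) ^ r * ‖g‖) := by gcongr
    _ = _ := by
      rw [eα, mul_pow, mul_pow, eβ]
      ring

end PeriodicGroup

theorem two_pow_succ_rpow (α : ℝ) (j : ℕ) :
    ((2 : ℝ) ^ (j + 1)) ^ α = 2 ^ α * ((2 : ℝ) ^ j) ^ α := by
  rw [pow_succ', mul_rpow (by norm_num) (by positivity)]

/-- Comparison of a dyadic sum with the corresponding weighted sum. -/
theorem sum_dyadic_le {α : ℝ} (hα : 0 ≤ α) {e E : ℕ → ℝ} (hE : ∀ ν, 0 ≤ E ν)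
    (h0 : e 0 ≤ 4 * E 1) (he : ∀ j ν, 1 ≤ ν → ν ≤ 2 ^ j → e (j + 1) ≤ 4 * E ν) (m : ℕ) :
    ∑ j ∈ Finset.range (m + 2), ((2 : ℝ) ^ j) ^ α * e j ≤
      8 * 4 ^ α * ∑ ν ∈ Finset.Icc (1 : ℕ) (2 ^ m), (ν : ℝ) ^ (α - 1) * E ν := by
  have h2 : (1 : ℝ) ≤ 2 ^ α := one_le_rpow (by norm_num) hα
  have h4 : (4 : ℝ) ^ α = 2 ^ α * 2 ^ α := by
    rw [← mul_rpow (by norm_num) (by norm_num)]; norm_num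
  induction m with
  | zero =>
    have h1 := he 0 1 le_rfl le_rfl
    have hE1 := hE 1
    simp only [Finset.sum_range_succ, Finset.range_zero, Finset.sum_empty, pow_zero, one_rpow,
      zero_add, pow_one, Finset.Icc_self, Finset.sum_singleton, Nat.cast_one, one_mul, h4] at h1 ⊢
    nlinarith [mul_le_mul_of_nonneg_left h1 (by linarith : (0 : ℝ) ≤ 2 ^ α),
      mul_nonneg (mul_nonneg (by linarith : (0 : ℝ) ≤ 2 ^ α) (sub_nonneg.2 h2)) hE1,
      mul_nonneg (sub_nonneg.2 h2) hE1]
  | succ m ih =>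
    have hsplit : Finset.Icc 1 (2 ^ (m + 1)) =
        (Finset.Icc 1 (2 ^ m)) ∪ (Finset.Ioc (2 ^ m) (2 ^ (m + 1))) := by
      ext ν
      have : 1 ≤ 2 ^ m := Nat.one_le_two_pow
      simp only [Finset.mem_Icc, Finset.mem_union, Finset.mem_Ioc, pow_succ]
      omega
    have hdisj : Disjoint (Finset.Icc 1 (2 ^ m)) (Finset.Ioc (2 ^ m) (2 ^ (m + 1))) := by
      rw [Finset.disjoint_left]
      intro ν h1 h2
      simp only [Finset.mem_Icc, Finset.mem_Ioc] at h1 h2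
      omega
    rw [Finset.sum_range_succ, hsplit, Finset.sum_union hdisj, mul_add]
    refine add_le_add ih ?_
    set c : ℝ := ((2 : ℝ) ^ m) ^ α / 2 ^ (m + 1) * (e (m + 2) / 4) with hc
    have hterm : ∀ ν ∈ Finset.Ioc (2 ^ m : ℕ) (2 ^ (m + 1)), c ≤ (ν : ℝ) ^ (α - 1) * E ν := by
      intro ν hν
      rw [Finset.mem_Ioc] at hν
      have hν1 : 1 ≤ ν := by omega
      have hνp : (0 : ℝ) < ν := by exact_mod_cast hν1
      have hl : (2 : ℝ) ^ m ≤ ν := by exact_mod_cast hν.1.le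
      have hu : (ν : ℝ) ≤ 2 ^ (m + 1) := by exact_mod_cast hν.2
      have h3 := he (m + 1) ν hν1 hν.2
      rw [rpow_sub_one hνp.ne', hc]
      calc _ ≤ ((2 : ℝ) ^ m) ^ α / 2 ^ (m + 1) * E ν := by
            gcongr; linarith
        _ ≤ _ := by
          have := hE ν
          gcongr
    have hsum := Finset.card_nsmul_le_sum _ _ _ hterm
    rw [Nat.card_Ioc, nsmul_eq_mul, Nat.cast_sub (by rw [pow_succ]; omega)] at hsum
    have e1 : (((2 ^ (m + 1) : ℕ) : ℝ) - ((2 ^ m : ℕ) : ℝ)) * c =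
        ((2 : ℝ) ^ m) ^ α * e (m + 2) / 8 := by
      rw [hc]; push_cast; rw [pow_succ]; field_simp; ring
    rw [e1] at hsum
    have h40 : (0 : ℝ) < 4 ^ α := by positivity
    calc _ = 8 * 4 ^ α * (((2 : ℝ) ^ m) ^ α * e (m + 2) / 8) := by
          rw [show m + 1 + 1 = m + 2 from rfl, two_pow_succ_rpow, two_pow_succ_rpow, h4]; ring
      _ ≤ _ := mul_le_mul_of_nonneg_left hsum (by positivity)

namespace PeriodicGroup

/-- The Bernstein–Stechkin inequality for a periodic group. -/
theorem exists_norm_oneSubRpow_le_sum (E : Type*) [NormedAddCommGroup E] [NormedSpace ℝ E]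
    [CompleteSpace E] {α : ℝ} (hα : 0 ≤ α) :
    ∃ C : ℝ, 0 ≤ C ∧ ∀ (T : PeriodicGroup E) (n : ℕ) (g : E) (s : ℝ),
      T.conv (valleeC 0) g = 0 → |s| ≤ π / (n + 1) →
      ‖oneSubRpow α (T s) g‖ ≤ C * ((n + 1 : ℝ) ^ (-α) *
        ∑ ν ∈ Finset.Icc 1 (n + 1), (ν : ℝ) ^ (α - 1) * ‖g - T.conv (valleeC (ν - 1)) g‖) := by
  obtain ⟨B, hB0, hB⟩ := exists_norm_oneSubRpow_apply_le E hα
  set A := ∑' n, |diffCoeff α n| with hA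
  have hA0 : 0 ≤ A := tsum_nonneg fun _ => abs_nonneg _
  have h20 : (0 : ℝ) < 2 ^ α := by positivity
  refine ⟨(A * 2 ^ α + B * 2 ^ α + 2 * B) * (8 * 4 ^ α) + B, by positivity, ?_⟩
  intro T n g s hg hs
  set D := oneSubRpow α (T s) with hD
  set V : ℕ → E →L[ℝ] E := fun n => T.conv (valleeC n) with hV
  set e : ℕ → ℝ := fun j => ‖g - V (2 ^ j) g‖ with he
  set En : ℕ → ℝ := fun ν => ‖g - V (ν - 1) g‖ with hEn
  set N : ℝ := n + 1 with hN
  have hNp : 0 < N := by positivity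
  have hNα : 0 < N ^ α := by positivity
  have hDA : ∀ x, ‖D x‖ ≤ A * ‖x‖ := fun x =>
    D.le_of_opNorm_le (norm_oneSubRpow_le hα (T.norm_pow_le s)) x
  obtain ⟨m, hm1, hm2⟩ : ∃ m : ℕ, 2 ^ m ≤ n + 1 ∧ n + 1 < 2 ^ (m + 1) :=
    ⟨Nat.log 2 (n + 1), Nat.pow_log_le_self 2 (by omega), Nat.lt_pow_succ_log_self (by norm_num) _⟩
  have hm1' : (2 : ℝ) ^ m ≤ N := by rw [hN]; exact_mod_cast hm1
  have hm2' : N ≤ 2 ^ (m + 1) := by rw [hN]; exact_mod_cast hm2.le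
  have hs' : N * |s| ≤ 3.15 := by
    rw [le_div_iff₀ hNp] at hs
    linarith [pi_lt_d2]
  have hdec : g = (g - V (2 ^ m) g) + ∑ j ∈ Finset.range m, (V (2 ^ (j + 1)) g - V (2 ^ j) g) +
      (V 1 g - V 0 g) := by
    rw [Finset.sum_range_sub (fun j => V (2 ^ j) g) m]
    simp only [hV, hg, pow_zero]
    abel
  set W := ∑ j ∈ Finset.range (m + 1), ((2 : ℝ) ^ j) ^ α * e j with hW
  have he0 : ∀ j, 0 ≤ e j := fun j => norm_nonneg _
  have hterm0 : ∀ j, 0 ≤ ((2 : ℝ) ^ j) ^ α * e j := fun j => mul_nonneg (by positivity) (he0 j)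
  have hWj : ∀ j ∈ Finset.range (m + 1), ((2 : ℝ) ^ j) ^ α * e j ≤ W := fun j hj =>
    Finset.single_le_sum (f := fun j => ((2 : ℝ) ^ j) ^ α * e j) (fun i _ => hterm0 i) hj
  have hfirst : N ^ α * ‖D (g - V (2 ^ m) g)‖ ≤ A * 2 ^ α * W := by
    calc N ^ α * ‖D (g - V (2 ^ m) g)‖ ≤ ((2 : ℝ) ^ (m + 1)) ^ α * (A * e m) := by
          gcongr; exact hDA _
      _ = A * 2 ^ α * (((2 : ℝ) ^ m) ^ α * e m) := by rw [two_pow_succ_rpow]; ring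
      _ ≤ _ := mul_le_mul_of_nonneg_left (hWj m (Finset.self_mem_range_succ m)) (by positivity)
  have hmid : ∀ j ∈ Finset.range m, N ^ α * ‖D (V (2 ^ (j + 1)) g - V (2 ^ j) g)‖ ≤
      B * (2 ^ α * (((2 : ℝ) ^ j) ^ α * e j) + ((2 : ℝ) ^ (j + 1)) ^ α * e (j + 1)) := by
    intro j hj
    have hjm : j + 1 ≤ m := Finset.mem_range.1 hj
    have hj1 : (2 : ℝ) ^ (j + 1) ≤ N := (pow_le_pow_right₀ (by norm_num) hjm).trans hm1'
    have := hB T (2 ^ (j + 2)) (V (2 ^ (j + 1)) g - V (2 ^ j) g) s (2 ^ (j + 1) / N) (by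
        simp only [hV, map_sub]
        rw [T.conv_vallee_conv_vallee (by rw [pow_succ' 2 (j + 1)]),
          T.conv_vallee_conv_vallee (by rw [pow_succ' 2 (j + 1), pow_succ' 2 j]; omega)])
      (by positivity) ((div_le_one hNp).2 hj1) (by
        rw [mul_div_assoc', le_div_iff₀ hNp]
        have h1 : (1 : ℝ) ≤ 2 ^ j := one_le_pow₀ (by norm_num)
        push_cast
        calc ((2 : ℝ) ^ (j + 2) + 1) * |s| * N = (2 ^ (j + 2) + 1) * (N * |s|) := by ring
          _ ≤ (2 ^ (j + 2) + 1) * 3.15 := by gcongr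
          _ ≤ _ := by rw [pow_succ, pow_succ]; linarith)
    rw [div_rpow (by positivity) hNp.le] at this
    have h3 : ‖V (2 ^ (j + 1)) g - V (2 ^ j) g‖ ≤ e j + e (j + 1) := by
      have : V (2 ^ (j + 1)) g - V (2 ^ j) g = (g - V (2 ^ j) g) - (g - V (2 ^ (j + 1)) g) := by abel
      rw [this]; exact norm_sub_le _ _
    calc _ ≤ N ^ α * (B * (((2 : ℝ) ^ (j + 1)) ^ α / N ^ α) * (e j + e (j + 1))) := by
          gcongr; exact this.trans (by gcongr)
      _ = B * (((2 : ℝ) ^ (j + 1)) ^ α * (e j + e (j + 1))) := by field_simp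
      _ = _ := by rw [two_pow_succ_rpow]; ring
  have hlast : N ^ α * ‖D (V 1 g - V 0 g)‖ ≤ B * (W + En 1) := by
    have := hB T 2 (V 1 g - V 0 g) s (1 / N) (by
        simp only [hV, map_sub]
        rw [T.conv_vallee_conv_vallee (by norm_num), T.conv_vallee_conv_vallee (by norm_num)])
      (by positivity) ((div_le_one hNp).2 (by rw [hN]; norm_num)) (by
        rw [mul_div_assoc', le_div_iff₀ hNp]
        push_cast
        linarith)
    rw [div_rpow (by positivity) hNp.le, one_rpow] at this
    have h3 : ‖V 1 g - V 0 g‖ ≤ e 0 + En 1 := by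
      have : V 1 g - V 0 g = (g - V 0 g) - (g - V 1 g) := by abel
      rw [this, add_comm]; exact norm_sub_le _ _
    have h4 : e 0 ≤ W := by simpa using hWj 0 (by simp)
    calc _ ≤ N ^ α * (B * (1 / N ^ α) * (W + En 1)) := by
          gcongr; exact this.trans (mul_le_mul_of_nonneg_left (by linarith) (by positivity))
      _ = _ := by field_simp
  have hmidsum : ∑ j ∈ Finset.range m,
      (2 ^ α * (((2 : ℝ) ^ j) ^ α * e j) + ((2 : ℝ) ^ (j + 1)) ^ α * e (j + 1)) ≤
      2 ^ α * W + W := by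
    rw [Finset.sum_add_distrib, ← Finset.mul_sum]
    have h1 : ∑ j ∈ Finset.range m, ((2 : ℝ) ^ j) ^ α * e j ≤ W := by
      rw [hW, Finset.sum_range_succ]; linarith [hterm0 m]
    have h2 : ∑ j ∈ Finset.range m, ((2 : ℝ) ^ (j + 1)) ^ α * e (j + 1) ≤ W := by
      rw [hW, Finset.sum_range_succ']; linarith [hterm0 0]
    gcongr
  have hEn0 : ∀ ν, 0 ≤ En ν := fun ν => norm_nonneg _
  set S := ∑ ν ∈ Finset.Icc 1 (n + 1), (ν : ℝ) ^ (α - 1) * En ν with hS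
  have hS0 : ∀ ν : ℕ, 0 ≤ (ν : ℝ) ^ (α - 1) * En ν := fun ν => mul_nonneg (by positivity) (hEn0 ν)
  have hS1 : En 1 ≤ S := by
    have := Finset.single_le_sum (f := fun ν : ℕ => (ν : ℝ) ^ (α - 1) * En ν)
      (fun i _ => hS0 i) (Finset.mem_Icc.2 ⟨le_rfl, by omega⟩ : 1 ∈ Finset.Icc 1 (n + 1))
    simpa using this
  have hWS : W ≤ 8 * 4 ^ α * S := by
    have h1 := sum_dyadic_le hα (e := e) (E := En) hEn0
      (T.norm_sub_conv_vallee_le (by norm_num) g)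
      (fun j ν h1 h2 => T.norm_sub_conv_vallee_le (by rw [pow_succ]; omega) g) m
    rw [Finset.sum_range_succ] at h1
    have h2 : ∑ ν ∈ Finset.Icc (1 : ℕ) (2 ^ m), (ν : ℝ) ^ (α - 1) * En ν ≤ S :=
      Finset.sum_le_sum_of_subset_of_nonneg (Finset.Icc_subset_Icc_right hm1) fun i _ _ => hS0 i
    calc W ≤ _ := by linarith [hterm0 (m + 1)]
      _ ≤ _ := h1
      _ ≤ _ := by gcongr
  have hmain : N ^ α * ‖D g‖ ≤ A * 2 ^ α * W + B * (2 ^ α * W + W) + B * (W + En 1) := by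
    conv_lhs => rw [hdec]
    simp only [_root_.map_add, map_sum]
    calc _ ≤ N ^ α * (‖D (g - V (2 ^ m) g)‖ +
          ∑ j ∈ Finset.range m, ‖D (V (2 ^ (j + 1)) g - V (2 ^ j) g)‖ + ‖D (V 1 g - V 0 g)‖) := by
          gcongr
          refine (norm_add_le _ _).trans (add_le_add_left ((norm_add_le _ _).trans
            (add_le_add_right (norm_sum_le _ _) _)) _)
      _ ≤ _ := by
        rw [mul_add, mul_add, Finset.mul_sum]
        refine add_le_add (add_le_add hfirst ((Finset.sum_le_sum hmid).trans ?_)) hlast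
        rw [← Finset.mul_sum]
        gcongr
  rw [rpow_neg hNp.le, mul_left_comm, ← div_eq_inv_mul, le_div_iff₀ hNα, mul_comm]
  calc _ ≤ _ := hmain
    _ = (A * 2 ^ α + B * 2 ^ α + 2 * B) * W + B * En 1 := by ring
    _ ≤ (A * 2 ^ α + B * 2 ^ α + 2 * B) * (8 * 4 ^ α * S) + B * S := by gcongr
    _ = _ := by ring

end PeriodicGroup

namespace PeriodicGroup

variable {E : Type*} [NormedAddCommGroup E] [NormedSpace ℝ E] (T : PeriodicGroup E)

theorem integral_cos_smul_of_not_dvd {j k : ℕ} (hk : 1 ≤ k) (h : ¬ k ∣ j) (g : E) :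
    ∫ t in -π..π, cos (j * t) • T (k * t) g = 0 := by
  have hk0 : (k : ℝ) ≠ 0 := by exact_mod_cast (by omega : k ≠ 0)
  set τ : ℝ := 2 * π / k with hτ
  have hkτ : ∀ t : ℝ, T (k * t + k * τ) g = T (k * t) g := fun t => by
    rw [hτ, mul_div_cancel₀ _ hk0, T.periodic]
  have hshift : ∀ φ : ℝ → E, Function.Periodic φ (2 * π) →
      ∫ t in -π..π, φ (t + τ) = ∫ t in -π..π, φ t := fun φ hφ => by
    rw [intervalIntegral.integral_comp_add_right φ]
    have := hφ.intervalIntegral_add_eq (-π + τ) (-π)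
    rwa [show -π + τ + 2 * π = π + τ by ring, show -π + 2 * π = π by ring] at this
  set A := ∫ t in -π..π, cos (j * t) • T (k * t) g with hA
  set B := ∫ t in -π..π, sin (j * t) • T (k * t) g with hB
  set c := cos (j * τ)
  set s := sin (j * τ)
  have hA1 : A = c • A - s • B := by
    conv_lhs => rw [hA, ← hshift (fun t => cos (j * t) • T (k * t) g) (fun t => by
      simp only [mul_add, T.periodic.nat_mul k _, cos_add_nat_mul_two_pi])]
    rw [hA, hB, ← intervalIntegral.integral_smul, ← intervalIntegral.integral_smul,
      ← intervalIntegral.integral_sub (by apply Continuous.intervalIntegrable; fun_prop)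
      (by apply Continuous.intervalIntegrable; fun_prop)]
    refine intervalIntegral.integral_congr fun t _ => ?_
    simp only [mul_add, hkτ, ← mul_smul, ← sub_smul, cos_add]
    congr 1; ring
  have hB1 : B = s • A + c • B := by
    conv_lhs => rw [hB, ← hshift (fun t => sin (j * t) • T (k * t) g) (fun t => by
      simp only [mul_add, T.periodic.nat_mul k _, sin_add_nat_mul_two_pi])]
    rw [hA, hB, ← intervalIntegral.integral_smul, ← intervalIntegral.integral_smul,
      ← intervalIntegral.integral_add (by apply Continuous.intervalIntegrable; fun_prop)
      (by apply Continuous.intervalIntegrable; fun_prop)]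
    refine intervalIntegral.integral_congr fun t _ => ?_
    simp only [mul_add, hkτ, ← mul_smul, ← add_smul, sin_add]
    congr 1; ring
  have hc : c ≠ 1 := by
    intro hc
    obtain ⟨i, hi⟩ := (cos_eq_one_iff _).1 hc
    apply h
    have h1 : (i * k : ℝ) = j := by
      rw [hτ] at hi
      have := pi_pos.ne'
      field_simp at hi
      linarith
    have h2 : i * (k : ℤ) = j := by exact_mod_cast h1
    exact Int.natCast_dvd_natCast.1 ⟨i, by rw [← h2, mul_comm]⟩
  have hcs : c ^ 2 + s ^ 2 = 1 := by rw [add_comm]; exact sin_sq_add_cos_sq _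
  have h3 : (1 - c) • A = -(s • B) := by rw [sub_smul, one_smul]; nth_rw 1 [hA1]; abel
  have h4 : (1 - c) • B = s • A := by rw [sub_smul, one_smul]; nth_rw 1 [hB1]; abel
  have h5 : (2 * (1 - c)) • A = 0 := by
    calc (2 * (1 - c)) • A = (1 - c) • ((1 - c) • A) + s • (s • A) := by
          rw [← mul_smul, ← mul_smul, ← add_smul]; congr 1; linear_combination -hcs
      _ = 0 := by rw [h3, ← h4, smul_neg, smul_comm]; abel
  rcases smul_eq_zero.1 h5 with h6 | h6
  · exact absurd (by linarith : c = 1) hc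
  · exact h6

theorem integral_cos_mul_smul {i k : ℕ} (hk : 1 ≤ k) (g : E) :
    ∫ t in -π..π, cos ((k * i : ℕ) * t) • T (k * t) g = T.conv (cosKernel i) g := by
  have hk0 : (k : ℝ) ≠ 0 := by exact_mod_cast (by omega : k ≠ 0)
  set φ : ℝ → E := fun u => cos (i * u) • T u g with hφ
  have hper : Function.Periodic φ (2 * π) := fun u => by
    simp only [hφ, mul_add, cos_add_nat_mul_two_pi, T.periodic u]
  have e : ∀ t : ℝ, cos ((k * i : ℕ) * t) • T (k * t) g = φ (k * t) := fun t => by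
    simp only [hφ]; congr 2; push_cast; ring
  simp only [e]
  rw [intervalIntegral.integral_comp_mul_left _ hk0]
  have h1 := hper.intervalIntegral_add_zsmul_eq k (k * -π)
    (by intro a b; apply Continuous.intervalIntegrable; fun_prop)
  rw [show (k : ℝ) * -π + (k : ℤ) • (2 * π) = k * π by simp; ring] at h1
  have h2 := hper.intervalIntegral_add_eq (k * -π) (-π)
  rw [show -π + 2 * π = π by ring] at h2
  rw [h1, h2, natCast_zsmul, ← Nat.cast_smul_eq_nsmul ℝ, ← mul_smul, inv_mul_cancel₀ hk0, one_smul]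
  rfl

end PeriodicGroup

/-- The kernel through which the average of `T (k t)` against `∑ a j cos (j t)` is expressed. -/
def dilateKernel (a : ℕ → ℝ) (n k : ℕ) : C(ℝ, ℝ) :=
  ∑ j ∈ Finset.range (n + 1), if k ∣ j then a j • cosKernel (j / k) else 0

theorem dilateKernel_mem_cosPoly (a : ℕ → ℝ) (n k : ℕ) : ⇑(dilateKernel a n k) ∈ cosPoly n := by
  have h : ∀ j ∈ Finset.range (n + 1),
      ⇑(if k ∣ j then a j • cosKernel (j / k) else 0) ∈ cosPoly n := by
    intro j hj
    have hj' := Finset.mem_range.1 hj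
    split_ifs
    · exact (cosPoly n).smul_mem _ (cos_mem_cosPoly ((Nat.div_le_self j k).trans (by omega)))
    · exact (cosPoly n).zero_mem
  have := (cosPoly n).sum_mem h
  rwa [← ContinuousMap.coe_sum] at this

namespace PeriodicGroup

variable {E : Type*} [NormedAddCommGroup E] [NormedSpace ℝ E] (T : PeriodicGroup E)

theorem integral_smul_dilate {K : ℝ → ℝ} {a : ℕ → ℝ} {n k : ℕ}
    (hK : ∀ t, K t = ∑ j ∈ Finset.range (n + 1), a j * cos (j * t)) (hk : 1 ≤ k) (g : E) :
    ∫ t in -π..π, K t • T (k * t) g = T.conv (dilateKernel a n k) g := by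
  simp only [hK, Finset.sum_smul, mul_smul]
  rw [intervalIntegral.integral_finsetSum fun j _ => by
    apply Continuous.intervalIntegrable; fun_prop, dilateKernel, ← convₗ_apply, map_sum, sum_apply]
  refine Finset.sum_congr rfl fun j _ => ?_
  rw [intervalIntegral.integral_smul]
  split_ifs with h
  · obtain ⟨i, rfl⟩ := h
    rw [T.integral_cos_mul_smul hk, Nat.mul_div_cancel_left i (by omega), _root_.map_smul]
    rfl
  · rw [T.integral_cos_smul_of_not_dvd hk h, smul_zero, _root_.map_zero]; rfl

/-- The kernel of the generalized Jackson operator. -/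
theorem exists_kernel_integral_one_sub_pow [CompleteSpace E] {K : ℝ → ℝ} {n : ℕ} (hK : K ∈ cosPoly n)
    (hKc : Continuous K) (hK1 : ∫ t in -π..π, K t = 1) (r : ℕ) :
    ∃ L : C(ℝ, ℝ), ⇑L ∈ cosPoly n ∧ ∀ (T : PeriodicGroup E) (g : E),
      ∫ t in -π..π, K t • ((1 - T t) ^ r) g = g - T.conv L g := by
  obtain ⟨a, ha⟩ := exists_coeff_of_mem_cosPoly hK
  refine ⟨-∑ k ∈ Finset.range r,
    ((-1) ^ (k + 1) * (r.choose (k + 1)) : ℝ) • dilateKernel a n (k + 1), ?_, fun T g => ?_⟩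
  · rw [ContinuousMap.coe_neg, ContinuousMap.coe_sum]
    exact (cosPoly n).neg_mem ((cosPoly n).sum_mem fun k _ =>
      (cosPoly n).smul_mem _ (dilateKernel_mem_cosPoly a n _))
  have hpow : ∀ t, ((1 - T t) ^ r) g =
      ∑ k ∈ Finset.range (r + 1), ((-1) ^ k * (r.choose k) : ℝ) • T (k * t) g := by
    intro t
    rw [sub_eq_neg_add, (Commute.one_right (-T t)).add_pow, sum_apply]
    refine Finset.sum_congr rfl fun k _ => ?_
    rw [T.map_natCast_mul, ← neg_one_smul ℝ (T t), smul_pow, one_pow, mul_one, ← nsmul_eq_mul',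
      ← Nat.cast_smul_eq_nsmul ℝ, ← mul_smul, smul_apply, mul_comm]
  simp only [hpow, Finset.smul_sum]
  rw [intervalIntegral.integral_finsetSum fun j _ => by
    apply Continuous.intervalIntegrable; fun_prop, Finset.sum_range_succ']
  simp only [smul_comm (K _), intervalIntegral.integral_smul]
  rw [Finset.sum_congr rfl fun k _ => by rw [T.integral_smul_dilate ha (by omega)]]
  simp only [Nat.cast_zero, zero_mul, T.map_zero]
  rw [intervalIntegral.integral_smul_const, hK1, ← convₗ_apply, map_neg, map_sum]
  simp only [map_smul]
  simp [convₗ_apply, sum_apply, add_comm]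

/-- The Jackson inequality for a periodic group. -/
theorem exists_norm_sub_conv_le (E : Type*) [NormedAddCommGroup E] [NormedSpace ℝ E]
    [CompleteSpace E] {α : ℝ} (hα : 0 ≤ α) :
    ∃ C : ℝ, 0 ≤ C ∧ ∀ n : ℕ, ∃ L : C(ℝ, ℝ), ⇑L ∈ cosPoly n ∧
      ∀ (T : PeriodicGroup E) (g : E) (M : ℝ),
        (∀ s, |s| ≤ π / (n + 1) → ‖oneSubRpow α (T s) g‖ ≤ M) → ‖g - T.conv L g‖ ≤ C * M := by
  obtain ⟨s, hs⟩ : ∃ s : ℕ, α ≤ (2 * s : ℕ) := by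
    obtain ⟨s, hs⟩ := exists_nat_ge α
    exact ⟨s, hs.trans (by push_cast; have : (0 : ℝ) ≤ s := s.cast_nonneg; linarith)⟩
  set A := ∑' n, |diffCoeff ((2 * s : ℕ) - α) n| with hA
  have hA0 : 0 ≤ A := tsum_nonneg fun _ => abs_nonneg _
  set c0 : ℝ := (2 * (1 + π ^ 2)) ^ s * (2 * π) * 4 ^ (s + 1) with hc0
  have hc00 : 0 ≤ c0 := by have := pi_pos; positivity
  refine ⟨(s + 1) ^ (2 * s) * A * c0, by positivity, fun n => ?_⟩
  set m := n / (s + 1) + 1 with hm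
  have hm1 : 1 ≤ m := Nat.succ_pos _
  have hmn : (s + 1) * (m - 1) ≤ n := by
    rw [hm, Nat.add_sub_cancel]; exact Nat.mul_div_le n (s + 1)
  have hnm : n + 1 ≤ (s + 1) * m := by
    rw [hm, mul_add, mul_one]
    have := Nat.lt_mul_div_succ n (Nat.succ_pos s)
    rw [Nat.mul_succ] at this
    exact this
  obtain ⟨L, hL, hLT⟩ := exists_kernel_integral_one_sub_pow (E := E)
    (jacksonKernel_mem_cosPoly s m hmn) (by fun_prop) (integral_jacksonKernel s hm1) (2 * s)
  refine ⟨L, hL, fun T g M hM => ?_⟩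
  have hM0 : 0 ≤ M := (norm_nonneg _).trans (hM 0 (by rw [abs_zero]; positivity))
  have hpt : ∀ t, ‖((1 - T t) ^ (2 * s)) g‖ ≤
      ((s + 1) * (1 + m * |t|)) ^ (2 * s) * (A * M) := by
    intro t
    set l := ⌊|t| * (n + 1) / π⌋₊ + 1 with hl
    have hl0 : (0 : ℝ) < l := by positivity
    have hlt : |t| * (n + 1) / π ≤ l := by
      rw [hl]; push_cast; exact (Nat.lt_floor_add_one _).le
    have hlu : (l : ℝ) ≤ (s + 1) * (1 + m * |t|) := by
      have h1 : (⌊|t| * (n + 1) / π⌋₊ : ℝ) ≤ |t| * (n + 1) / π := Nat.floor_le (by positivity)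
      have h2 : |t| * (n + 1) / π ≤ |t| * (n + 1) :=
        div_le_self (by positivity) (by linarith [pi_gt_three])
      have h3 : (n + 1 : ℝ) ≤ (s + 1) * m := by exact_mod_cast hnm
      have h4 := mul_le_mul_of_nonneg_left h3 (abs_nonneg t)
      rw [hl]; push_cast
      have : (0 : ℝ) ≤ s := s.cast_nonneg
      nlinarith
    set h := t / l with hh
    have hhle : |h| ≤ π / (n + 1) := by
      rw [hh, abs_div, abs_of_pos hl0, div_le_div_iff₀ hl0 (by positivity)]
      rw [div_le_iff₀ pi_pos] at hlt
      linarith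
    have hU := T.norm_pow_le h
    have ht : T t = T h ^ l := by
      rw [← T.map_natCast_mul, hh, mul_div_cancel₀ _ hl0.ne']
    set G := ∑ i ∈ Finset.range l, T h ^ i with hG
    have hGn : ‖G‖ ≤ l := by
      calc ‖G‖ ≤ ∑ i ∈ Finset.range l, ‖T h ^ i‖ := norm_sum_le _ _
        _ ≤ ∑ i ∈ Finset.range l, (1 : ℝ) := Finset.sum_le_sum fun i _ => hU i
        _ = l := by simp
    have hcomm : Commute G (1 - T h) :=
      (Commute.one_right _).sub_right (Commute.sum_left _ _ _ fun i _ => (Commute.refl _).pow_left i)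
    have hfac : (1 - T t) ^ (2 * s) = G ^ (2 * s) *
        (oneSubRpow ((2 * s : ℕ) - α) (T h) * oneSubRpow α (T h)) := by
      rw [ht, ← geom_sum_mul_neg, hcomm.mul_pow, ← oneSubRpow_add (sub_nonneg.2 hs) hα hU,
        sub_add_cancel, oneSubRpow_natCast _ hU]
    rw [hfac, mul_apply_eq_comp, mul_apply_eq_comp]
    have hGr : ∀ (r : ℕ) (x : E), ‖(G ^ r) x‖ ≤ (l : ℝ) ^ r * ‖x‖ := by
      intro r x
      induction r with
      | zero => simp
      | succ r ih =>
        rw [pow_succ', mul_apply_eq_comp, pow_succ', mul_assoc]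
        exact G.le_of_opNorm_le_of_le hGn ih
    calc _ ≤ (l : ℝ) ^ (2 * s) *
          (‖oneSubRpow ((2 * s : ℕ) - α) (T h)‖ * ‖oneSubRpow α (T h) g‖) :=
          (hGr _ _).trans
            (mul_le_mul_of_nonneg_left (ContinuousLinearMap.le_opNorm _ _) (by positivity))
      _ ≤ (l : ℝ) ^ (2 * s) * (A * M) := by
          gcongr
          · exact norm_oneSubRpow_le (sub_nonneg.2 hs) hU
          · exact hM h hhle
      _ ≤ _ := by gcongr
  rw [← hLT T g]
  calc _ ≤ ∫ t in -π..π, jacksonKernel s m t * (1 + m * |t|) ^ (2 * s) *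
        ((s + 1) ^ (2 * s) * (A * M)) := by
        refine intervalIntegral.norm_integral_le_of_norm_le (by linarith [pi_pos])
          (Filter.Eventually.of_forall fun t _ => ?_)
          (by apply Continuous.intervalIntegrable; fun_prop)
        rw [norm_smul, norm_eq_abs, abs_of_nonneg (jacksonKernel_nonneg s hm1 t)]
        calc _ ≤ jacksonKernel s m t * (((s + 1) * (1 + m * |t|)) ^ (2 * s) * (A * M)) :=
              mul_le_mul_of_nonneg_left (hpt t) (jacksonKernel_nonneg s hm1 t)
          _ = _ := by rw [mul_pow]; ring
    _ ≤ c0 * ((s + 1) ^ (2 * s) * (A * M)) := by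
        rw [intervalIntegral.integral_mul_const]
        exact mul_le_mul_of_nonneg_right (integral_jacksonKernel_mul_le s hm1) (by positivity)
    _ = _ := by ring

end PeriodicGroup

namespace PeriodicGroup

variable (E : Type*) [NormedAddCommGroup E] [NormedSpace ℝ E] [CompleteSpace E]

theorem exists_norm_angular_sub_le {α₁ α₂ : ℝ} (hα₁ : 0 ≤ α₁) (hα₂ : 0 ≤ α₂) :
    ∃ C : ℝ, 0 ≤ C ∧ ∀ n₁ n₂ : ℕ, ∃ L₁ L₂ : C(ℝ, ℝ), ⇑L₁ ∈ cosPoly n₁ ∧ ⇑L₂ ∈ cosPoly n₂ ∧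
      ∀ S T : PeriodicGroup E, (∀ s t, Commute (S s) (T t)) → ∀ (g : E) (M : ℝ),
        (∀ s t, |s| ≤ π / (n₁ + 1) → |t| ≤ π / (n₂ + 1) →
          ‖oneSubRpow α₁ (S s) (oneSubRpow α₂ (T t) g)‖ ≤ M) →
        ‖(g - T.conv L₂ g) - S.conv L₁ (g - T.conv L₂ g)‖ ≤ C * M := by
  obtain ⟨C₁, hC₁, h₁⟩ := exists_norm_sub_conv_le E hα₁
  obtain ⟨C₂, hC₂, h₂⟩ := exists_norm_sub_conv_le E hα₂
  refine ⟨C₁ * C₂, by positivity, fun n₁ n₂ => ?_⟩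
  obtain ⟨L₁, hL₁, h₁⟩ := h₁ n₁
  obtain ⟨L₂, hL₂, h₂⟩ := h₂ n₂
  refine ⟨L₁, L₂, hL₁, hL₂, fun S T hST g M hM => ?_⟩
  rw [mul_assoc]
  refine h₁ S _ _ fun s hs => ?_
  have hST' : ∀ t, Commute (oneSubRpow α₁ (S s)) (T t) := fun t =>
    (commute_oneSubRpow hα₁ (S.norm_pow_le s) (hST s t).symm).symm
  have hc : oneSubRpow α₁ (S s) (T.conv L₂ g) = T.conv L₂ (oneSubRpow α₁ (S s) g) :=
    DFunLike.congr_fun (T.commute_conv hST' L₂).eq g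
  rw [_root_.map_sub, hc]
  refine h₂ T _ _ fun t ht => ?_
  have hc' : oneSubRpow α₂ (T t) (oneSubRpow α₁ (S s) g) =
      oneSubRpow α₁ (S s) (oneSubRpow α₂ (T t) g) :=
    DFunLike.congr_fun (commute_oneSubRpow hα₂ (T.norm_pow_le t) (hST' t)).eq.symm g
  rw [hc']
  exact hM s t hs ht

theorem exists_norm_mixed_le_sum {α₁ α₂ : ℝ} (hα₁ : 0 ≤ α₁) (hα₂ : 0 ≤ α₂) :
    ∃ C : ℝ, 0 ≤ C ∧ ∀ S T : PeriodicGroup E, (∀ s t, Commute (S s) (T t)) →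
      ∀ (n₁ n₂ : ℕ) (g : E) (s t : ℝ), S.conv (valleeC 0) g = 0 → T.conv (valleeC 0) g = 0 →
      |s| ≤ π / (n₁ + 1) → |t| ≤ π / (n₂ + 1) →
      ‖oneSubRpow α₁ (S s) (oneSubRpow α₂ (T t) g)‖ ≤
        C * ((n₁ + 1 : ℝ) ^ (-α₁) * (n₂ + 1 : ℝ) ^ (-α₂) *
          ∑ ν₁ ∈ Finset.Icc 1 (n₁ + 1), ∑ ν₂ ∈ Finset.Icc 1 (n₂ + 1),
            (ν₁ : ℝ) ^ (α₁ - 1) * (ν₂ : ℝ) ^ (α₂ - 1) *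
              ‖(g - S.conv (valleeC (ν₁ - 1)) g) -
                T.conv (valleeC (ν₂ - 1)) (g - S.conv (valleeC (ν₁ - 1)) g)‖) := by
  obtain ⟨C₁, hC₁, h₁⟩ := exists_norm_oneSubRpow_le_sum E hα₁
  obtain ⟨C₂, hC₂, h₂⟩ := exists_norm_oneSubRpow_le_sum E hα₂
  refine ⟨C₁ * C₂, by positivity, fun S T hST n₁ n₂ g s t hS hT hs ht => ?_⟩
  have hc : ∀ K, Commute (oneSubRpow α₂ (T t)) (S.conv K) := fun K =>
    S.commute_conv (fun s => (commute_oneSubRpow hα₂ (T.norm_pow_le t) (hST s t)).symm) K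
  have hc' : ∀ K L, Commute (T.conv L) (S.conv K) := fun K L =>
    S.commute_conv (fun s => (T.commute_conv (fun t => hST s t) L).symm) K
  have e : ∀ K, oneSubRpow α₂ (T t) g - S.conv K (oneSubRpow α₂ (T t) g) =
      oneSubRpow α₂ (T t) (g - S.conv K g) := fun K => by
    rw [_root_.map_sub]; congr 1; exact (DFunLike.congr_fun (hc K).eq g).symm
  have hS' : S.conv (valleeC 0) (oneSubRpow α₂ (T t) g) = 0 := by
    have := (DFunLike.congr_fun (hc (valleeC 0)).eq g).symm
    simp only [mul_apply_eq_comp, hS, _root_.map_zero] at this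
    exact this
  have hT' : ∀ K, T.conv (valleeC 0) (g - S.conv K g) = 0 := fun K => by
    have := DFunLike.congr_fun (hc' K (valleeC 0)).eq g
    simp only [mul_apply_eq_comp, hT, _root_.map_zero] at this
    rw [_root_.map_sub, this, hT, sub_zero]
  refine (h₁ S n₁ _ s hS' hs).trans ?_
  simp only [e]
  calc _ ≤ C₁ * ((n₁ + 1 : ℝ) ^ (-α₁) * ∑ ν₁ ∈ Finset.Icc 1 (n₁ + 1), (ν₁ : ℝ) ^ (α₁ - 1) *
        (C₂ * ((n₂ + 1 : ℝ) ^ (-α₂) * ∑ ν₂ ∈ Finset.Icc 1 (n₂ + 1), (ν₂ : ℝ) ^ (α₂ - 1) *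
          ‖(g - S.conv (valleeC (ν₁ - 1)) g) -
                T.conv (valleeC (ν₂ - 1)) (g - S.conv (valleeC (ν₁ - 1)) g)‖))) := by
        gcongr with ν₁ _
        exact h₂ T n₂ _ t (hT' _) ht
    _ = _ := by
        simp only [Finset.mul_sum]
        refine Finset.sum_congr rfl fun _ _ => Finset.sum_congr rfl fun _ _ => ?_
        ring

end PeriodicGroup

section

instance : Fact (0 < 2 * π) := ⟨two_pi_pos⟩

/-- The two-dimensional torus `(ℝ / 2πℤ)²`. -/
abbrev Torus : Type := AddCircle (2 * π) × AddCircle (2 * π)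

theorem measurePreserving_add_right_torus (w : Torus) :
    MeasurePreserving (fun z : Torus => z + w) volume volume := by
  have := (measurePreserving_add_right (volume : Measure (AddCircle (2 * π))) w.1).prod
    (measurePreserving_add_right (volume : Measure (AddCircle (2 * π))) w.2)
  exact this

instance : (volume : Measure Torus).IsAddRightInvariant :=
  ⟨fun w => (measurePreserving_add_right_torus w).map_eq⟩

variable {q : ℝ≥0∞} [hq : Fact (1 ≤ q)] [hq' : Fact (q ≠ ∞)]

/-- The group of translations along a closed one-parameter subgroup of the torus, acting on
`L_q`. -/
def translationGroup (q : ℝ≥0∞) [Fact (1 ≤ q)] [hq' : Fact (q ≠ ∞)] (τ : ℝ →+ Torus)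
    (hτ : Continuous τ) (hτ' : τ (2 * π) = 0) :
    PeriodicGroup (Lp ℝ q (volume : Measure Torus)) where
  toFun t := (Lp.compMeasurePreservingₗᵢ ℝ (fun z : Torus => z + τ t)
    (measurePreserving_add_right_torus (τ t))).toContinuousLinearMap
  map_zero' := by
    ext1 g
    change Lp.compMeasurePreserving _ _ g = g
    apply Lp.ext
    filter_upwards [Lp.coeFn_compMeasurePreserving g (measurePreserving_add_right_torus (τ 0))]
      with z hz
    rw [hz]; simp
  map_add' s t := by
    ext1 g
    change Lp.compMeasurePreserving _ _ g =
      Lp.compMeasurePreserving _ _ (Lp.compMeasurePreserving _ _ g)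
    apply Lp.ext
    have h1 := Lp.coeFn_compMeasurePreserving g (measurePreserving_add_right_torus (τ (s + t)))
    have h2 := Lp.coeFn_compMeasurePreserving g (measurePreserving_add_right_torus (τ t))
    have h3 := Lp.coeFn_compMeasurePreserving
      (Lp.compMeasurePreserving _ (measurePreserving_add_right_torus (τ t)) g)
      (measurePreserving_add_right_torus (τ s))
    have h4 := (measurePreserving_add_right_torus (τ s)).quasiMeasurePreserving.ae h2
    filter_upwards [h1, h3, h4] with z h1 h3 h4
    rw [h1, h3]
    simp only [Function.comp_apply] at h4 ⊢
    rw [h4, map_add, add_assoc]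
  norm_map' t g := LinearIsometry.norm_map _ g
  continuous' g := by
    refine Continuous.compMeasurePreservingLp (E := ℝ) (p := q) (f := fun _ : ℝ => g)
      (g := fun t => (⟨fun z : Torus => z + τ t, by fun_prop⟩ : C(Torus, Torus)))
      continuous_const ?_ (fun t => measurePreserving_add_right_torus (τ t)) hq'.out
    exact ContinuousMap.continuous_of_continuous_uncurry _ (by
      simp only [Function.uncurry_def, ContinuousMap.coe_mk]; fun_prop)
  periodic' t := by
    have : τ (t + 2 * π) = τ t := by rw [map_add, hτ', add_zero]
    simp only [this]

theorem translationGroup_ae {τ : ℝ →+ Torus} (hτ : Continuous τ) (hτ' : τ (2 * π) = 0) (t : ℝ)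
    (g : Lp ℝ q (volume : Measure Torus)) :
    translationGroup q τ hτ hτ' t g =ᵐ[volume] fun z => g (z + τ t) :=
  Lp.coeFn_compMeasurePreserving g (measurePreserving_add_right_torus (τ t))

theorem translationGroup_commute {τ σ : ℝ →+ Torus} (hτ : Continuous τ) (hτ' : τ (2 * π) = 0)
    (hσ : Continuous σ) (hσ' : σ (2 * π) = 0) (s t : ℝ) :
    Commute (translationGroup q τ hτ hτ' s) (translationGroup q σ hσ hσ' t) := by
  ext1 g
  apply Lp.ext
  change translationGroup q τ hτ hτ' s (translationGroup q σ hσ hσ' t g) =ᵐ[volume]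
    translationGroup q σ hσ hσ' t (translationGroup q τ hτ hτ' s g)
  filter_upwards [translationGroup_ae hτ hτ' s (translationGroup q σ hσ hσ' t g),
    translationGroup_ae hσ hσ' t (translationGroup q τ hτ hτ' s g),
    (measurePreserving_add_right_torus (τ s)).quasiMeasurePreserving.ae
      (translationGroup_ae hσ hσ' t g),
    (measurePreserving_add_right_torus (σ t)).quasiMeasurePreserving.ae
      (translationGroup_ae hτ hτ' s g)] with z h1 h2 h3 h4
  rw [h1, h2, h3, h4, add_right_comm]

end

section

variable {q : ℝ≥0∞} [hq : Fact (1 ≤ q)]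

theorem integrable_Lp_torus (g : Lp ℝ q (volume : Measure Torus)) : Integrable g volume :=
  (Lp.memLp g).integrable hq.out

/-- Integration over a set as a continuous functional on `L_q` of the torus. -/
def setIntegralCLM (q : ℝ≥0∞) [hq : Fact (1 ≤ q)] (s : Set Torus) :
    Lp ℝ q (volume : Measure Torus) →L[ℝ] ℝ :=
  LinearMap.mkContinuous
    { toFun := fun g => ∫ z in s, g z
      map_add' := fun g g' => by
        rw [← integral_add (integrable_Lp_torus g).integrableOn
          (integrable_Lp_torus g').integrableOn]
        exact integral_congr_ae (ae_restrict_of_ae (Lp.coeFn_add g g'))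
      map_smul' := fun c g => by
        rw [RingHom.id_apply, ← integral_smul]
        exact integral_congr_ae (ae_restrict_of_ae (Lp.coeFn_smul c g)) }
    ((volume (Set.univ : Set Torus) ^ (1 / (1 : ℝ≥0∞).toReal - 1 / q.toReal)).toReal)
    fun g => by
      have hg := integrable_Lp_torus g
      have h0 : 0 ≤ 1 / (1 : ℝ≥0∞).toReal - 1 / q.toReal := by
        rcases eq_or_ne q ∞ with h | h
        · simp [h]
        · have : 1 ≤ q.toReal := by
            rw [← ENNReal.toReal_one]; exact ENNReal.toReal_mono h hq.out
          rw [ENNReal.toReal_one, one_div_one, sub_nonneg]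
          exact (div_le_one (by linarith)).2 this
      calc ‖∫ z in s, g z‖ ≤ ∫ z in s, ‖g z‖ := norm_integral_le_integral_norm _
        _ ≤ ∫ z, ‖g z‖ := setIntegral_le_integral hg.norm (Filter.Eventually.of_forall
            fun z => norm_nonneg _)
        _ = (eLpNorm g 1 volume).toReal := by
            rw [integral_norm_eq_lintegral_enorm hg.aestronglyMeasurable, eLpNorm_one_eq_lintegral_enorm]
        _ ≤ (eLpNorm g q volume *
            volume (Set.univ : Set Torus) ^ (1 / (1 : ℝ≥0∞).toReal - 1 / q.toReal)).toReal :=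
            ENNReal.toReal_mono (ENNReal.mul_ne_top (Lp.memLp g).eLpNorm_ne_top
              (ENNReal.rpow_ne_top_of_nonneg h0 (measure_ne_top _ _)))
              (eLpNorm_le_eLpNorm_mul_rpow_measure_univ hq.out hg.aestronglyMeasurable)
        _ = _ := by rw [ENNReal.toReal_mul, mul_comm, Lp.norm_def]

theorem setIntegralCLM_apply (s : Set Torus) (g : Lp ℝ q (volume : Measure Torus)) :
    setIntegralCLM q s g = ∫ z in s, g z := rfl

theorem integrable_kernel_mul_translate {τ : ℝ →+ Torus} (hτ : Continuous τ) {K : ℝ → ℝ}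
    (hK : Continuous K) {G : Torus → ℝ} (hG : Measurable G) (hG' : Integrable G volume) :
    Integrable (fun w : Torus × ℝ => K w.2 * G (w.1 + τ w.2))
      ((volume : Measure Torus).prod (volume.restrict (Set.Ioc (-π) π))) := by
  have hm : Measurable (fun w : Torus × ℝ => K w.2 * G (w.1 + τ w.2)) := by
    have := hτ.measurable
    have := hK.measurable
    fun_prop
  rw [integrable_prod_iff' hm.aestronglyMeasurable]
  refine ⟨Filter.Eventually.of_forall fun t => ?_, ?_⟩
  · exact ((measurePreserving_add_right_torus (τ t)).integrable_comp_of_integrable hG').const_mul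
      (K t)
  · have : ∀ t, ∫ z, ‖K t * G (z + τ t)‖ = |K t| * ∫ z, ‖G z‖ := by
      intro t
      simp only [norm_mul, norm_eq_abs]
      rw [integral_const_mul]
      congr 1
      exact integral_add_right_eq_self (μ := (volume : Measure Torus)) (fun z => |G z|) (τ t)
    simp only [this]
    exact ((hK.abs.integrableOn_Icc (a := -π) (b := π)).mono_set Set.Ioc_subset_Icc_self).mul_const _

theorem conv_translationGroup_ae [Fact (q ≠ ∞)] {τ : ℝ →+ Torus} (hτ : Continuous τ) (hτ' : τ (2 * π) = 0)
    (K : C(ℝ, ℝ)) {G : Torus → ℝ} (hG : Measurable G)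
    {g : Lp ℝ q (volume : Measure Torus)} (hg : g =ᵐ[volume] G) :
    (translationGroup q τ hτ hτ').conv K g =ᵐ[volume]
      fun z => ∫ t in -π..π, K t * G (z + τ t) := by
  have hGi : Integrable G volume := (integrable_Lp_torus g).congr hg
  have hi := integrable_kernel_mul_translate hτ K.continuous hG hGi
  have hpi : -π ≤ π := by linarith [pi_pos]
  simp only [intervalIntegral.integral_of_le hpi]
  refine Integrable.ae_eq_of_forall_setIntegral_eq _ _ (integrable_Lp_torus _)
    hi.integral_prod_left fun s hs _ => ?_
  have h1 : ∫ z in s, ∫ t in Set.Ioc (-π) π, K t * G (z + τ t) =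
      ∫ t in Set.Ioc (-π) π, ∫ z in s, K t * G (z + τ t) :=
    integral_integral_swap (f := fun z t => K t * G (z + τ t)) (by
      have := hi.restrict (s := s ×ˢ Set.univ)
      rwa [← Measure.prod_restrict, Measure.restrict_univ] at this)
  have hc : IntervalIntegrable (fun t => K t • translationGroup q τ hτ hτ' t g) volume (-π) π :=
    (K.continuous.smul (PeriodicGroup.continuous_apply _ continuous_id g)).intervalIntegrable _ _
  rw [h1, ← setIntegralCLM_apply, PeriodicGroup.conv_apply,
    ← ContinuousLinearMap.intervalIntegral_comp_comm _
      hc,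
    intervalIntegral.integral_of_le hpi]
  congr 1
  ext t
  rw [map_smul, setIntegralCLM_apply, smul_eq_mul, integral_const_mul]
  congr 1
  refine integral_congr_ae (ae_restrict_of_ae ?_)
  filter_upwards [translationGroup_ae hτ hτ' t g,
    (measurePreserving_add_right_torus (τ t)).quasiMeasurePreserving.ae hg] with z h1 h2
  rw [h1, h2]

end

section

variable {q : ℝ≥0∞} [hq : Fact (1 ≤ q)]

theorem PeriodicGroup.apply_oneSubRpow {E : Type*} [NormedAddCommGroup E] [NormedSpace ℝ E]
    [CompleteSpace E] (T : PeriodicGroup E) {α : ℝ} (hα : 0 ≤ α) (h : ℝ) (g : E) :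
    T (α * h) (oneSubRpow α (T (-h)) g) =
      ∑' ν : ℕ, diffCoeff α ν • T ((α - ν) * h) g := by
  have hsum : HasSum (fun ν : ℕ => diffCoeff α ν • T (-h) ^ ν) (oneSubRpow α (T (-h))) :=
    (summable_norm_diffCoeff_smul hα (T.norm_pow_le _)).of_norm.hasSum
  have hsum' := (hsum.mapL (ContinuousLinearMap.apply ℝ E g)).mapL (T (α * h))
  rw [ContinuousLinearMap.apply_apply] at hsum'
  rw [← hsum'.tsum_eq]
  refine tsum_congr fun ν => ?_
  have : (α - ν) * h = α * h + ν * (-h) := by ring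
  rw [this, T.map_add, T.map_natCast_mul]
  simp

theorem translationGroup_oneSubRpow_ae [Fact (q ≠ ∞)] {τ : ℝ →+ Torus} (hτ : Continuous τ)
    (hτ' : τ (2 * π) = 0) {α : ℝ} (hα : 0 ≤ α) (h : ℝ) {G : Torus → ℝ}
    {g : Lp ℝ q (volume : Measure Torus)} (hg : g =ᵐ[volume] G) :
    translationGroup q τ hτ hτ' (α * h)
      (oneSubRpow α (translationGroup q τ hτ hτ' (-h)) g) =ᵐ[volume]
      fun z => ∑' ν : ℕ, diffCoeff α ν * G (z + τ ((α - ν) * h)) := by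
  set T := translationGroup q τ hτ hτ' with hT
  have hfin : ∑' ν : ℕ, ‖diffCoeff α ν • T ((α - ν) * h) g‖ₑ ≠ ∞ := by
    have : Summable fun ν : ℕ => ‖diffCoeff α ν • T ((α - ν) * h) g‖ := by
      simp only [norm_smul, T.norm_map, norm_eq_abs]
      exact (summable_abs_diffCoeff hα).mul_right _
    simp only [← ofReal_norm]
    exact this.tsum_ofReal_ne_top
  have key := Lp.coeFn_tsum hfin
  rw [T.apply_oneSubRpow hα]
  refine key.trans ?_
  have hall : ∀ᵐ z ∂(volume : Measure Torus), ∀ ν : ℕ,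
      (diffCoeff α ν • T ((α - ν) * h) g) z = diffCoeff α ν * G (z + τ ((α - ν) * h)) := by
    rw [ae_all_iff]
    intro ν
    filter_upwards [Lp.coeFn_smul (diffCoeff α ν) (T ((α - ν) * h) g),
      translationGroup_ae hτ hτ' ((α - ν) * h) g,
      (measurePreserving_add_right_torus (τ ((α - ν) * h))).quasiMeasurePreserving.ae hg]
      with z h1 h2 h3
    rw [h1, Pi.smul_apply, smul_eq_mul, h2, h3]
  filter_upwards [hall] with z hz
  simp only [hz]

/-- The representative in `(0, 2π]` of a point of the circle. -/
def circleRep (w : AddCircle (2 * π)) : ℝ := (AddCircle.equivIoc (2 * π) 0 w : ℝ)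

theorem coe_circleRep (w : AddCircle (2 * π)) : (circleRep w : AddCircle (2 * π)) = w :=
  (AddCircle.equivIoc (2 * π) 0).symm_apply_apply w

@[fun_prop]
theorem measurable_circleRep : Measurable circleRep :=
  measurable_subtype_coe.comp (AddCircle.measurableEquivIoc (2 * π) 0).measurable

theorem apply_circleRep_coe {φ : ℝ → ℝ} (hφ : Function.Periodic φ (2 * π)) (x : ℝ) :
    φ (circleRep (x : AddCircle (2 * π))) = φ x := by
  have := coe_circleRep (x : AddCircle (2 * π))
  calc φ (circleRep (x : AddCircle (2 * π))) = hφ.lift (circleRep (x : AddCircle (2 * π))) := rfl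
    _ = hφ.lift (x : AddCircle (2 * π)) := by rw [this]
    _ = φ x := rfl

/-- The function on the torus induced by a function of two variables on `(0, 2π]²`. -/
def torusLift (f : ℝ → ℝ → ℝ) (z : Torus) : ℝ := f (circleRep z.1) (circleRep z.2)

/-- A function of two variables that is `2π`-periodic in each of them. -/
structure BiPeriodic (f : ℝ → ℝ → ℝ) : Prop where
  left : ∀ y, Function.Periodic (fun x => f x y) (2 * π)
  right : ∀ x, Function.Periodic (f x) (2 * π)

theorem BiPeriodic.torusLift_coe {f : ℝ → ℝ → ℝ} (hf : BiPeriodic f) (x y : ℝ) :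
    torusLift f ((x : AddCircle (2 * π)), (y : AddCircle (2 * π))) = f x y := by
  unfold torusLift
  rw [apply_circleRep_coe (hf.left _), apply_circleRep_coe (hf.right _)]

theorem measurable_torusLift {f : ℝ → ℝ → ℝ} (hf : Measurable (Function.uncurry f)) :
    Measurable (torusLift f) :=
  hf.comp (f := fun z : Torus => (circleRep z.1, circleRep z.2)) (by fun_prop)

theorem Lp2Norm_eq_eLpNorm {p : ℝ} (hp : 1 ≤ p) {f : ℝ → ℝ → ℝ}
    (hf : AEMeasurable (torusLift f) volume) :
    Lp2Norm p f = eLpNorm (torusLift f) (ENNReal.ofReal p) volume := by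
  have hp0 : ENNReal.ofReal p ≠ 0 := by simpa using lt_of_lt_of_le one_pos hp
  have e : ∀ x y, ENNReal.ofReal (|f x y| ^ p) = ‖f x y‖ₑ ^ p := by
    intro x y
    rw [← ofReal_norm, ENNReal.ofReal_rpow_of_nonneg (norm_nonneg _) (by linarith), norm_eq_abs]
  have hmem : ∀ x ∈ Set.Ioc (0 : ℝ) (2 * π), circleRep (x : AddCircle (2 * π)) = x := by
    intro x hx
    have : AddCircle.equivIoc (2 * π) 0 x = ⟨x, by simpa using hx⟩ :=
      (AddCircle.equivIoc (2 * π) 0).apply_symm_apply ⟨x, by simpa using hx⟩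
    unfold circleRep
    rw [this]
  rw [eLpNorm_eq_lintegral_rpow_enorm_toReal hp0 ENNReal.ofReal_ne_top,
    ENNReal.toReal_ofReal (by linarith), Lp2Norm, Measure.volume_eq_prod,
    lintegral_prod _ (hf.enorm.pow_const p)]
  congr 1
  rw [← AddCircle.lintegral_preimage (2 * π) 0, zero_add]
  refine setLIntegral_congr_fun measurableSet_Ioc fun x hx => ?_
  rw [← AddCircle.lintegral_preimage (2 * π) 0, zero_add]
  refine setLIntegral_congr_fun measurableSet_Ioc fun y hy => ?_
  simp only [torusLift, hmem x hx, hmem y hy, e]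

theorem biPeriodic_diffY {f : ℝ → ℝ → ℝ} (hf : BiPeriodic f) (α h : ℝ) :
    BiPeriodic (diffY α h f) where
  left y x := by simp only [diffY, (hf.left _) x]
  right x y := by simp only [diffY, add_right_comm, (hf.right x) _]

theorem biPeriodic_diffX {f : ℝ → ℝ → ℝ} (hf : BiPeriodic f) (α h : ℝ) :
    BiPeriodic (diffX α h f) where
  left y x := by
    have := fun t => (hf.left y) t
    simp only at this
    simp only [diffX, add_right_comm, this]
  right x y := by simp only [diffX, (hf.right _) y]

/-- The one-parameter subgroup of the torus in the first variable. -/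
def torusX : ℝ →+ Torus where
  toFun t := (t, 0)
  map_zero' := rfl
  map_add' s t := by simp

/-- The one-parameter subgroup of the torus in the second variable. -/
def torusY : ℝ →+ Torus where
  toFun t := (0, t)
  map_zero' := rfl
  map_add' s t := by simp

theorem torusX_apply (t : ℝ) : torusX t = ((t : AddCircle (2 * π)), 0) := rfl

theorem torusY_apply (t : ℝ) : torusY t = (0, (t : AddCircle (2 * π))) := rfl

theorem continuous_torusX : Continuous torusX :=
  (AddCircle.continuous_mk' (2 * π)).prodMk continuous_const

theorem continuous_torusY : Continuous torusY :=
  continuous_const.prodMk (AddCircle.continuous_mk' (2 * π))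

theorem torusX_two_pi : torusX (2 * π) = 0 := by
  rw [torusX_apply, AddCircle.coe_period]; rfl

theorem torusY_two_pi : torusY (2 * π) = 0 := by
  rw [torusY_apply, AddCircle.coe_period]; rfl

/-- Translations in the first variable on `L_q` of the torus. -/
def translationX (q : ℝ≥0∞) [Fact (1 ≤ q)] [Fact (q ≠ ∞)] :
    PeriodicGroup (Lp ℝ q (volume : Measure Torus)) :=
  translationGroup q torusX continuous_torusX torusX_two_pi

/-- Translations in the second variable on `L_q` of the torus. -/
def translationY (q : ℝ≥0∞) [Fact (1 ≤ q)] [Fact (q ≠ ∞)] :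
    PeriodicGroup (Lp ℝ q (volume : Measure Torus)) :=
  translationGroup q torusY continuous_torusY torusY_two_pi

theorem exists_coe_eq (z : Torus) :
    ∃ x y : ℝ, z = ((x : AddCircle (2 * π)), (y : AddCircle (2 * π))) :=
  ⟨circleRep z.1, circleRep z.2, by rw [coe_circleRep, coe_circleRep]⟩

theorem torusLift_diffX {f : ℝ → ℝ → ℝ} (hf : BiPeriodic f) (α h : ℝ) :
    torusLift (diffX α h f) =
      fun z => ∑' ν : ℕ, diffCoeff α ν * torusLift f (z + torusX ((α - ν) * h)) := by
  ext z
  obtain ⟨x, y, rfl⟩ := exists_coe_eq z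
  rw [(biPeriodic_diffX hf α h).torusLift_coe]
  refine tsum_congr fun ν => ?_
  rw [torusX_apply, Prod.mk_add_mk, add_zero, ← AddCircle.coe_add, hf.torusLift_coe, diffCoeff]

theorem torusLift_diffY {f : ℝ → ℝ → ℝ} (hf : BiPeriodic f) (α h : ℝ) :
    torusLift (diffY α h f) =
      fun z => ∑' ν : ℕ, diffCoeff α ν * torusLift f (z + torusY ((α - ν) * h)) := by
  ext z
  obtain ⟨x, y, rfl⟩ := exists_coe_eq z
  rw [(biPeriodic_diffY hf α h).torusLift_coe]
  refine tsum_congr fun ν => ?_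
  rw [torusY_apply, Prod.mk_add_mk, add_zero, ← AddCircle.coe_add, hf.torusLift_coe, diffCoeff]

theorem commute_translation [Fact (q ≠ ∞)] (s t : ℝ) :
    Commute (translationX q s) (translationY q t) :=
  translationGroup_commute _ _ _ _ s t

theorem Lp2Norm_diff_eq {p : ℝ} (hp : 1 ≤ p) [Fact (1 ≤ ENNReal.ofReal p)]
    [Fact (ENNReal.ofReal p ≠ ∞)] {f : ℝ → ℝ → ℝ} (hf : BiPeriodic f)
    {g : Lp ℝ (ENNReal.ofReal p) (volume : Measure Torus)} (hg : g =ᵐ[volume] torusLift f)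
    {α₁ α₂ : ℝ} (hα₁ : 0 ≤ α₁) (hα₂ : 0 ≤ α₂) (h₁ h₂ : ℝ) :
    Lp2Norm p (diffX α₁ h₁ (diffY α₂ h₂ f)) =
      ENNReal.ofReal ‖oneSubRpow α₁ (translationX (ENNReal.ofReal p) (-h₁))
        (oneSubRpow α₂ (translationY (ENNReal.ofReal p) (-h₂)) g)‖ := by
  set S := translationX (ENNReal.ofReal p)
  set T := translationY (ENNReal.ofReal p)
  have hy := translationGroup_oneSubRpow_ae continuous_torusY torusY_two_pi hα₂ h₂ hg
  rw [← torusLift_diffY hf] at hy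
  have hx := translationGroup_oneSubRpow_ae continuous_torusX torusX_two_pi hα₁ h₁ hy
  rw [← torusLift_diffX (biPeriodic_diffY hf _ _)] at hx
  change S (α₁ * h₁) (oneSubRpow α₁ (S (-h₁)) (T (α₂ * h₂) (oneSubRpow α₂ (T (-h₂)) g))) =ᵐ[volume]
    _ at hx
  have hcomm : Commute (T (α₂ * h₂)) (oneSubRpow α₁ (S (-h₁))) :=
    commute_oneSubRpow hα₁ (S.norm_pow_le _) (commute_translation _ _).symm
  have hc : oneSubRpow α₁ (S (-h₁)) (T (α₂ * h₂) (oneSubRpow α₂ (T (-h₂)) g)) =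
      T (α₂ * h₂) (oneSubRpow α₁ (S (-h₁)) (oneSubRpow α₂ (T (-h₂)) g)) :=
    (DFunLike.congr_fun hcomm.eq (oneSubRpow α₂ (T (-h₂)) g)).symm
  rw [Lp2Norm_eq_eLpNorm hp ((Lp.aestronglyMeasurable _).aemeasurable.congr hx),
    ← eLpNorm_congr_ae hx, ← Lp.enorm_def, ← ofReal_norm, S.norm_map, hc, T.norm_map]

end

theorem integral_valleeKernel_mul_trig {n : ℕ} (a b : ℕ → ℝ) {φ : ℝ → ℝ}
    (hφ : ∀ x, φ x = ∑ k ∈ Finset.range (n + 1), (a k * cos (k * x) + b k * sin (k * x))) (x : ℝ) :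
    ∫ t in -π..π, valleeKernel n t * φ (x + t) = φ x := by
  have hc := continuous_valleeKernel n
  have e : ∀ t, valleeKernel n t * φ (x + t) = ∑ k ∈ Finset.range (n + 1),
      ((a k * cos (k * x) + b k * sin (k * x)) * (valleeKernel n t * cos (k * t)) +
        (b k * cos (k * x) - a k * sin (k * x)) * (valleeKernel n t * sin (k * t))) := by
    intro t
    rw [hφ, Finset.mul_sum]
    refine Finset.sum_congr rfl fun k _ => ?_
    rw [mul_add (k : ℝ), cos_add, sin_add]; ring
  simp only [e]
  rw [intervalIntegral.integral_finsetSum fun _ _ => by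
      apply Continuous.intervalIntegrable; fun_prop, hφ]
  refine Finset.sum_congr rfl fun k hk => ?_
  rw [intervalIntegral.integral_add (by apply Continuous.intervalIntegrable; fun_prop)
      (by apply Continuous.intervalIntegrable; fun_prop),
    intervalIntegral.integral_const_mul, intervalIntegral.integral_const_mul,
    integral_valleeKernel_mul_cos (by have := Finset.mem_range.1 hk; omega),
    integral_mul_sin_of_mem_cosPoly (valleeKernel_mem_cosPoly n), mul_one, mul_zero, add_zero]

theorem periodic_trig {n : ℕ} (a b : ℕ → ℝ) {φ : ℝ → ℝ}
    (hφ : ∀ x, φ x = ∑ k ∈ Finset.range (n + 1), (a k * cos (k * x) + b k * sin (k * x))) :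
    Function.Periodic φ (2 * π) := by
  intro x
  rw [hφ, hφ]
  refine Finset.sum_congr rfl fun k _ => ?_
  rw [mul_add, cos_add_nat_mul_two_pi, sin_add_nat_mul_two_pi]

theorem TrigPolyX.biPeriodic {p : ℝ} {m : ℕ} {T : ℝ → ℝ → ℝ} (h : TrigPolyX p m T) :
    BiPeriodic T := by
  obtain ⟨-, -, hy, a, b, hab⟩ := h
  exact ⟨fun y => periodic_trig (fun k => a k y) (fun k => b k y) fun x => hab x y, hy⟩

theorem TrigPolyY.biPeriodic {p : ℝ} {m : ℕ} {T : ℝ → ℝ → ℝ} (h : TrigPolyY p m T) :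
    BiPeriodic T := by
  obtain ⟨-, -, hx, a, b, hab⟩ := h
  exact ⟨hx, fun x => periodic_trig (fun k => a k x) (fun k => b k x) fun y => hab x y⟩

theorem memLp_torusLift {p : ℝ} (hp : 1 ≤ p) {f : ℝ → ℝ → ℝ} (hf : Measurable (Function.uncurry f))
    (hf' : Lp2Norm p f ≠ ⊤) : MemLp (torusLift f) (ENNReal.ofReal p) volume := by
  have hm := measurable_torusLift hf
  rw [Lp2Norm_eq_eLpNorm hp hm.aemeasurable] at hf'
  exact ⟨hm.aestronglyMeasurable, hf'.lt_top⟩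

theorem quasiMeasurePreserving_circleRep :
    Measure.QuasiMeasurePreserving circleRep volume volume := by
  refine ⟨measurable_circleRep, ?_⟩
  have h1 := AddCircle.measurePreserving_equivIoc (T := 2 * π) (a := 0)
  have h2 : Measure.map circleRep volume = volume.restrict (Set.Ioc 0 (0 + 2 * π)) := by
    rw [← map_comap_subtype_coe measurableSet_Ioc, ← h1.map_eq,
      Measure.map_map measurable_subtype_coe h1.measurable]
    rfl
  rw [h2]
  exact Measure.restrict_le_self.absolutelyContinuous

theorem integral_valleeKernel_zero_mul {φ : ℝ → ℝ} (hφ : Function.Periodic φ (2 * π))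
    (h0 : ∫ x in (0 : ℝ)..(2 * π), φ x = 0) (x : ℝ) :
    ∫ t in -π..π, valleeKernel 0 t * φ (x + t) = 0 := by
  have e : ∀ t, valleeKernel 0 t = (2 * π)⁻¹ := by
    intro t
    simp [valleeKernel, fejerSum]
  have := hφ.intervalIntegral_add_eq (x - π) 0
  rw [zero_add, h0] at this
  simp only [e]
  rw [intervalIntegral.integral_const_mul, intervalIntegral.integral_comp_add_left,
    show x + -π = x - π by ring, show x + π = x - π + 2 * π by ring, this, mul_zero]

section

variable {q : ℝ≥0∞} [Fact (1 ≤ q)] [Fact (q ≠ ∞)]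

theorem conv_vallee_translationX_eq_self {n : ℕ} {f : ℝ → ℝ → ℝ}
    (hm : Measurable (Function.uncurry f)) (hf : BiPeriodic f)
    (hab : ∃ a b : ℕ → ℝ → ℝ, ∀ x y, f x y = ∑ k ∈ Finset.range (n + 1),
      (a k y * cos (k * x) + b k y * sin (k * x)))
    {g : Lp ℝ q (volume : Measure Torus)} (hg : g =ᵐ[volume] torusLift f) :
    (translationX q).conv (valleeC n) g = g := by
  obtain ⟨a, b, hab⟩ := hab
  apply Lp.ext
  refine ((conv_translationGroup_ae continuous_torusX torusX_two_pi _ (measurable_torusLift hm)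
    hg).trans (Filter.Eventually.of_forall fun z => ?_)).trans hg.symm
  obtain ⟨x, y, rfl⟩ := exists_coe_eq z
  simp only [torusX_apply, Prod.mk_add_mk, add_zero, ← AddCircle.coe_add, hf.torusLift_coe,
    valleeC_apply]
  exact integral_valleeKernel_mul_trig (φ := fun x => f x y) (fun k => a k y) (fun k => b k y)
    (fun x => hab x y) x

theorem conv_vallee_translationY_eq_self {n : ℕ} {f : ℝ → ℝ → ℝ}
    (hm : Measurable (Function.uncurry f)) (hf : BiPeriodic f)
    (hab : ∃ a b : ℕ → ℝ → ℝ, ∀ x y, f x y = ∑ k ∈ Finset.range (n + 1),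
      (a k x * cos (k * y) + b k x * sin (k * y)))
    {g : Lp ℝ q (volume : Measure Torus)} (hg : g =ᵐ[volume] torusLift f) :
    (translationY q).conv (valleeC n) g = g := by
  obtain ⟨a, b, hab⟩ := hab
  apply Lp.ext
  refine ((conv_translationGroup_ae continuous_torusY torusY_two_pi _ (measurable_torusLift hm)
    hg).trans (Filter.Eventually.of_forall fun z => ?_)).trans hg.symm
  obtain ⟨x, y, rfl⟩ := exists_coe_eq z
  simp only [torusY_apply, Prod.mk_add_mk, add_zero, ← AddCircle.coe_add, hf.torusLift_coe,
    valleeC_apply]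
  exact integral_valleeKernel_mul_trig (φ := f x) (fun k => a k x) (fun k => b k x)
    (fun y => hab x y) y

theorem conv_vallee_zero_translationX {f : ℝ → ℝ → ℝ} (hm : Measurable (Function.uncurry f))
    (hf : BiPeriodic f) (hmean : ∀ᵐ y : ℝ, (∫ x in (0 : ℝ)..(2 * π), f x y) = 0)
    {g : Lp ℝ q (volume : Measure Torus)} (hg : g =ᵐ[volume] torusLift f) :
    (translationX q).conv (valleeC 0) g = 0 := by
  apply Lp.ext
  refine ((conv_translationGroup_ae continuous_torusX torusX_two_pi _ (measurable_torusLift hm)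
    hg).trans ?_).trans (Lp.coeFn_zero ℝ q volume).symm
  filter_upwards [(Measure.quasiMeasurePreserving_snd (μ := (volume : Measure (AddCircle (2 * π))))
    (ν := (volume : Measure (AddCircle (2 * π))))).ae (quasiMeasurePreserving_circleRep.ae hmean)]
    with z hz
  have hz' : z = ((circleRep z.1 : AddCircle (2 * π)), (circleRep z.2 : AddCircle (2 * π))) := by
    rw [coe_circleRep, coe_circleRep]
  rw [hz']
  simp only [torusX_apply, Prod.mk_add_mk, add_zero, ← AddCircle.coe_add, hf.torusLift_coe,
    valleeC_apply, Pi.zero_apply]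
  exact integral_valleeKernel_zero_mul (hf.left _) hz _

theorem conv_vallee_zero_translationY {f : ℝ → ℝ → ℝ} (hm : Measurable (Function.uncurry f))
    (hf : BiPeriodic f) (hmean : ∀ᵐ x : ℝ, (∫ y in (0 : ℝ)..(2 * π), f x y) = 0)
    {g : Lp ℝ q (volume : Measure Torus)} (hg : g =ᵐ[volume] torusLift f) :
    (translationY q).conv (valleeC 0) g = 0 := by
  apply Lp.ext
  refine ((conv_translationGroup_ae continuous_torusY torusY_two_pi _ (measurable_torusLift hm)
    hg).trans ?_).trans (Lp.coeFn_zero ℝ q volume).symm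
  filter_upwards [(Measure.quasiMeasurePreserving_fst (μ := (volume : Measure (AddCircle (2 * π))))
    (ν := (volume : Measure (AddCircle (2 * π))))).ae (quasiMeasurePreserving_circleRep.ae hmean)]
    with z hz
  have hz' : z = ((circleRep z.1 : AddCircle (2 * π)), (circleRep z.2 : AddCircle (2 * π))) := by
    rw [coe_circleRep, coe_circleRep]
  rw [hz']
  simp only [torusY_apply, Prod.mk_add_mk, add_zero, ← AddCircle.coe_add, hf.torusLift_coe,
    valleeC_apply, Pi.zero_apply]
  exact integral_valleeKernel_zero_mul (hf.right _) hz _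

end

theorem PeriodicGroup.norm_sub_vallee_sub_vallee_le {E : Type*} [NormedAddCommGroup E]
    [NormedSpace ℝ E] [CompleteSpace E] (S T : PeriodicGroup E)
    (hST : ∀ s t, Commute (S s) (T t)) {n₁ n₂ : ℕ} {g₁ g₂ : E} (g : E)
    (h₁ : S.conv (valleeC n₁) g₁ = g₁) (h₂ : T.conv (valleeC n₂) g₂ = g₂) :
    ‖(g - S.conv (valleeC n₁) g) - T.conv (valleeC n₂) (g - S.conv (valleeC n₁) g)‖ ≤
      16 * ‖g - g₁ - g₂‖ := by
  set A := S.conv (valleeC n₁)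
  set B := T.conv (valleeC n₂)
  have hAB : Commute A B :=
    T.commute_conv (fun t => (S.commute_conv (fun s => (hST s t).symm) _).symm) _
  have hAB' : A (B g₂) = B (A g₂) := DFunLike.congr_fun hAB.eq g₂
  have e : (g - A g) - B (g - A g) =
      (g - g₁ - g₂ - A (g - g₁ - g₂)) - B (g - g₁ - g₂ - A (g - g₁ - g₂)) := by
    rw [h₂] at hAB'
    simp only [_root_.map_sub, h₁, h₂, ← hAB']
    abel
  have h4 : ∀ u, ‖u - A u‖ ≤ 4 * ‖u‖ := fun u => by
    linarith [norm_sub_le u (A u), S.norm_conv_vallee_le n₁ u]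
  have h4' : ∀ u, ‖u - B u‖ ≤ 4 * ‖u‖ := fun u => by
    linarith [norm_sub_le u (B u), T.norm_conv_vallee_le n₂ u]
  rw [e]
  linarith [h4' (g - g₁ - g₂ - A (g - g₁ - g₂)), h4 (g - g₁ - g₂)]

theorem integrable_comp_coe_circle {φ : AddCircle (2 * π) → ℝ} (hφ : Integrable φ volume) :
    IntegrableOn (fun u : ℝ => φ u) (Set.Ioc (-π) π) := by
  have := (AddCircle.measurePreserving_mk (2 * π) (-π)).integrable_comp_of_integrable hφ
  rwa [show -π + 2 * π = π by ring] at this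

/-- The convolution in the first variable with the kernel `∑ⱼ aⱼ cos (j t)`, as a
trigonometric sum. -/
def trigSum (a : ℕ → ℝ) (n : ℕ) (G : Torus → ℝ) (x y : ℝ) : ℝ :=
  ∑ j ∈ Finset.range (n + 1),
    ((a j * ∫ u in -π..π, cos (j * u) * G (u, y)) * cos (j * x) +
      (a j * ∫ u in -π..π, sin (j * u) * G (u, y)) * sin (j * x))

theorem measurable_trigSum (a : ℕ → ℝ) (n : ℕ) {G : Torus → ℝ} (hG : Measurable G) :
    Measurable (Function.uncurry (trigSum a n G)) := by
  have hI : ∀ k : ℝ → ℝ, Measurable k →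
      Measurable fun y : ℝ => ∫ u in -π..π, k u * G (u, y) := by
    intro k hk
    simp only [intervalIntegral.integral_of_le (show -π ≤ π by linarith [pi_pos])]
    have hc : Measurable ((↑) : ℝ → AddCircle (2 * π)) :=
      (AddCircle.continuous_mk' (2 * π)).measurable
    have hm : Measurable (Function.uncurry fun y u : ℝ => k u * G (u, y)) := by
      simp only [Function.uncurry_def]
      fun_prop
    exact (hm.stronglyMeasurable.integral_prod_right'
      (ν := volume.restrict (Set.Ioc (-π) π))).measurable
  have h1 := fun j : ℕ => (hI (fun u => cos (j * u)) (by fun_prop)).comp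
    (measurable_snd : Measurable (Prod.snd : ℝ × ℝ → ℝ))
  have h2 := fun j : ℕ => (hI (fun u => sin (j * u)) (by fun_prop)).comp
    (measurable_snd : Measurable (Prod.snd : ℝ × ℝ → ℝ))
  simp only [Function.comp_def] at h1 h2
  simp only [Function.uncurry_def, trigSum]
  fun_prop

theorem biPeriodic_trigSum (a : ℕ → ℝ) (n : ℕ) (G : Torus → ℝ) : BiPeriodic (trigSum a n G) where
  left y := periodic_trig _ _ fun _ => rfl
  right x y := by simp only [trigSum, AddCircle.coe_add_period]

theorem torusLift_trigSum_ae {a : ℕ → ℝ} {n : ℕ} {L : ℝ → ℝ}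
    (hL : ∀ t, L t = ∑ j ∈ Finset.range (n + 1), a j * cos (j * t))
    {G : Torus → ℝ} (hG : Integrable G volume) :
    ∀ᵐ z ∂(volume : Measure Torus),
      torusLift (trigSum a n G) z = ∫ t in -π..π, L t * G (z + torusX t) := by
  have h := (Measure.quasiMeasurePreserving_snd (μ := (volume : Measure (AddCircle (2 * π))))
    (ν := (volume : Measure (AddCircle (2 * π))))).ae hG.prod_left_ae
  filter_upwards [h] with z hz
  obtain ⟨x, y, rfl⟩ := exists_coe_eq z
  have hi : IntegrableOn (fun u : ℝ => G (u, y)) (Set.Icc (-π) π) :=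
    (integrableOn_Icc_iff_integrableOn_Ioc).2 (integrable_comp_coe_circle hz)
  have hpi : -π ≤ π := by linarith [pi_pos]
  have hk : ∀ k : ℝ → ℝ, Continuous k →
      IntervalIntegrable (fun u : ℝ => k u * G (u, y)) volume (-π) π := fun k hk =>
    (intervalIntegrable_iff_integrableOn_Icc_of_le hpi).2
      (hi.continuousOn_mul hk.continuousOn isCompact_Icc)
  have hper : Function.Periodic (fun u : ℝ => L (u - x) * G (u, y)) (2 * π) := by
    intro u
    simp only [AddCircle.coe_add_period, add_sub_right_comm, hL, mul_add,
      cos_add_nat_mul_two_pi]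
  have hshift : ∫ t in -π..π, L t * G (((x : AddCircle (2 * π)), (y : AddCircle (2 * π))) + torusX t) =
      ∫ u in -π..π, L (u - x) * G (u, y) := by
    have e : ∀ t : ℝ, L t * G (((x : AddCircle (2 * π)), (y : AddCircle (2 * π))) + torusX t) =
        (fun u : ℝ => L (u - x) * G (u, y)) (x + t) := by
      intro t
      simp [torusX_apply]
    simp only [e]
    rw [intervalIntegral.integral_comp_add_left (fun u : ℝ => L (u - x) * G (u, y))]
    have := hper.intervalIntegral_add_eq (x + -π) (-π)
    rwa [show x + -π + 2 * π = x + π by ring, show -π + 2 * π = π by ring] at this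
  rw [(biPeriodic_trigSum a n G).torusLift_coe, hshift]
  have e : ∀ u : ℝ, L (u - x) * G (u, y) = ∑ j ∈ Finset.range (n + 1),
      ((a j * cos (j * x)) * (cos (j * u) * G (u, y)) +
        (a j * sin (j * x)) * (sin (j * u) * G (u, y))) := by
    intro u
    rw [hL, Finset.sum_mul]
    refine Finset.sum_congr rfl fun j _ => ?_
    rw [mul_sub, cos_sub]; ring
  simp only [e]
  have hc := fun j : ℕ => (hk (fun u => cos (j * u)) (by fun_prop)).const_mul (a j * cos (j * x))
  have hs := fun j : ℕ => (hk (fun u => sin (j * u)) (by fun_prop)).const_mul (a j * sin (j * x))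
  rw [intervalIntegral.integral_finsetSum fun j _ => (hc j).add (hs j), trigSum]
  refine Finset.sum_congr rfl fun j _ => ?_
  rw [intervalIntegral.integral_add (hc j) (hs j), intervalIntegral.integral_const_mul,
    intervalIntegral.integral_const_mul]
  ring

/-- The convolution in the second variable with the kernel `∑ⱼ aⱼ cos (j t)`, as a
trigonometric sum. -/
def trigSumY (a : ℕ → ℝ) (n : ℕ) (G : Torus → ℝ) (x y : ℝ) : ℝ :=
  trigSum a n (fun w => G w.swap) y x

theorem measurable_uncurry_flip {F : ℝ → ℝ → ℝ} (hF : Measurable (Function.uncurry F)) :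
    Measurable (Function.uncurry fun x y => F y x) :=
  hF.comp measurable_swap

theorem measurable_trigSumY (a : ℕ → ℝ) (n : ℕ) {G : Torus → ℝ} (hG : Measurable G) :
    Measurable (Function.uncurry (trigSumY a n G)) := by
  have hG' : Measurable fun w : Torus => G w.swap := hG.comp measurable_swap
  exact measurable_uncurry_flip (measurable_trigSum a n hG')

theorem torusLift_trigSumY_ae {a : ℕ → ℝ} {n : ℕ} {L : ℝ → ℝ}
    (hL : ∀ t, L t = ∑ j ∈ Finset.range (n + 1), a j * cos (j * t))
    {G : Torus → ℝ} (hG : Integrable G volume) :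
    ∀ᵐ z ∂(volume : Measure Torus),
      torusLift (trigSumY a n G) z = ∫ t in -π..π, L t * G (z + torusY t) := by
  have hswap : MeasurePreserving (Prod.swap : Torus → Torus) volume volume :=
    Measure.measurePreserving_swap
  filter_upwards [hswap.quasiMeasurePreserving.ae (torusLift_trigSum_ae hL
    (hswap.integrable_comp_of_integrable hG))] with z hz
  exact hz

section

variable {p : ℝ} [Fact (1 ≤ ENNReal.ofReal p)] [Fact (ENNReal.ofReal p ≠ ∞)]

theorem exists_trigPolyX_ae (hp : 1 ≤ p) {n : ℕ} {L : C(ℝ, ℝ)} (hL : ⇑L ∈ cosPoly n)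
    (g : Lp ℝ (ENNReal.ofReal p) (volume : Measure Torus)) :
    ∃ P, TrigPolyX p n P ∧ (translationX (ENNReal.ofReal p)).conv L g =ᵐ[volume] torusLift P := by
  obtain ⟨a, ha⟩ := exists_coeff_of_mem_cosPoly hL
  have hG : Measurable g := (Lp.stronglyMeasurable g).measurable
  have hm := measurable_trigSum a n hG
  have hae : (translationX (ENNReal.ofReal p)).conv L g =ᵐ[volume] torusLift (trigSum a n g) :=
    (conv_translationGroup_ae continuous_torusX torusX_two_pi L hG Filter.EventuallyEq.rfl).trans
      (Filter.EventuallyEq.symm (torusLift_trigSum_ae ha (integrable_Lp_torus g)))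
  refine ⟨trigSum a n g, ⟨hm, ?_, (biPeriodic_trigSum a n g).right, _, _, fun x y => rfl⟩, hae⟩
  rw [Lp2Norm_eq_eLpNorm hp (measurable_torusLift hm).aemeasurable, ← eLpNorm_congr_ae hae]
  exact Lp.eLpNorm_ne_top _

theorem exists_trigPolyY_ae (hp : 1 ≤ p) {n : ℕ} {L : C(ℝ, ℝ)} (hL : ⇑L ∈ cosPoly n)
    (g : Lp ℝ (ENNReal.ofReal p) (volume : Measure Torus)) :
    ∃ P, TrigPolyY p n P ∧ (translationY (ENNReal.ofReal p)).conv L g =ᵐ[volume] torusLift P := by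
  obtain ⟨a, ha⟩ := exists_coeff_of_mem_cosPoly hL
  have hG : Measurable g := (Lp.stronglyMeasurable g).measurable
  have hm := measurable_trigSumY a n hG
  have hae : (translationY (ENNReal.ofReal p)).conv L g =ᵐ[volume] torusLift (trigSumY a n g) :=
    (conv_translationGroup_ae continuous_torusY torusY_two_pi L hG Filter.EventuallyEq.rfl).trans
      (Filter.EventuallyEq.symm (torusLift_trigSumY_ae ha (integrable_Lp_torus g)))
  refine ⟨trigSumY a n g, ⟨hm, ?_, fun y => (biPeriodic_trigSum a n fun w => g w.swap).right y,
    _, _, fun x y => rfl⟩, hae⟩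
  rw [Lp2Norm_eq_eLpNorm hp (measurable_torusLift hm).aemeasurable, ← eLpNorm_congr_ae hae]
  exact Lp.eLpNorm_ne_top _

theorem Yapprox_le (hp : 1 ≤ p) {n₁ n₂ : ℕ} {L₁ L₂ : C(ℝ, ℝ)} (hL₁ : ⇑L₁ ∈ cosPoly n₁)
    (hL₂ : ⇑L₂ ∈ cosPoly n₂) {f : ℝ → ℝ → ℝ}
    {g : Lp ℝ (ENNReal.ofReal p) (volume : Measure Torus)} (hg : g =ᵐ[volume] torusLift f) :
    Yapprox p n₁ n₂ f ≤ ENNReal.ofReal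
      ‖(g - (translationY (ENNReal.ofReal p)).conv L₂ g) -
        (translationX (ENNReal.ofReal p)).conv L₁
          (g - (translationY (ENNReal.ofReal p)).conv L₂ g)‖ := by
  set u := (translationY (ENNReal.ofReal p)).conv L₂ g with hu
  set v := (translationX (ENNReal.ofReal p)).conv L₁ (g - u) with hv
  obtain ⟨P₂, hP₂, h₂⟩ := exists_trigPolyY_ae hp hL₂ g
  obtain ⟨P₁, hP₁, h₁⟩ := exists_trigPolyX_ae hp hL₁ (g - u)
  have hae : (g - u - v : Lp ℝ (ENNReal.ofReal p) (volume : Measure Torus)) =ᵐ[volume]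
      torusLift fun x y => f x y - P₁ x y - P₂ x y := by
    filter_upwards [Lp.coeFn_sub (g - u) v, Lp.coeFn_sub g u, hg, h₁, h₂] with z e1 e2 e3 e4 e5
    rw [e1, Pi.sub_apply, e2, Pi.sub_apply, e3, e4, e5]
    simp only [torusLift]; ring
  refine (iInf₂_le_of_le P₁ hP₁ (iInf₂_le P₂ hP₂)).trans (le_of_eq ?_)
  rw [Lp2Norm_eq_eLpNorm hp ((Lp.aestronglyMeasurable _).aemeasurable.congr hae),
    ← eLpNorm_congr_ae hae, ← Lp.enorm_def, ofReal_norm]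

theorem ofReal_norm_le_Yapprox (hp : 1 ≤ p) (n₁ n₂ : ℕ) {f : ℝ → ℝ → ℝ}
    {g : Lp ℝ (ENNReal.ofReal p) (volume : Measure Torus)} (hg : g =ᵐ[volume] torusLift f) :
    ENNReal.ofReal ‖(g - (translationX (ENNReal.ofReal p)).conv (valleeC n₁) g) -
      (translationY (ENNReal.ofReal p)).conv (valleeC n₂)
        (g - (translationX (ENNReal.ofReal p)).conv (valleeC n₁) g)‖ ≤
      16 * Yapprox p n₁ n₂ f := by
  simp only [Yapprox, ENNReal.mul_iInf_of_ne (show (16 : ℝ≥0∞) ≠ 0 by norm_num)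
    (show (16 : ℝ≥0∞) ≠ ∞ by norm_num)]
  refine le_iInf₂ fun P₁ hP₁ => le_iInf₂ fun P₂ hP₂ => ?_
  have hm₁ := memLp_torusLift hp hP₁.1 hP₁.2.1
  have hm₂ := memLp_torusLift hp hP₂.1 hP₂.2.1
  have h₁ := conv_vallee_translationX_eq_self hP₁.1 hP₁.biPeriodic hP₁.2.2.2 hm₁.coeFn_toLp
  have h₂ := conv_vallee_translationY_eq_self hP₂.1 hP₂.biPeriodic hP₂.2.2.2 hm₂.coeFn_toLp
  have hae : (g - hm₁.toLp - hm₂.toLp : Lp ℝ (ENNReal.ofReal p) (volume : Measure Torus))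
      =ᵐ[volume] torusLift fun x y => f x y - P₁ x y - P₂ x y := by
    filter_upwards [Lp.coeFn_sub (g - hm₁.toLp) hm₂.toLp, Lp.coeFn_sub g hm₁.toLp, hg,
      hm₁.coeFn_toLp, hm₂.coeFn_toLp] with z e1 e2 e3 e4 e5
    rw [e1, Pi.sub_apply, e2, Pi.sub_apply, e3, e4, e5]
    rfl
  rw [Lp2Norm_eq_eLpNorm hp ((Lp.aestronglyMeasurable _).aemeasurable.congr hae),
    ← eLpNorm_congr_ae hae, ← Lp.enorm_def, ← ofReal_norm,
    show (16 : ℝ≥0∞) = ENNReal.ofReal 16 by simp, ← ENNReal.ofReal_mul (by norm_num)]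
  exact ENNReal.ofReal_le_ofReal
    (PeriodicGroup.norm_sub_vallee_sub_vallee_le _ _ commute_translation g h₁ h₂)

end

/-- Jackson and Bernstein–Stechkin type inequalities for the best angular
approximation in terms of the mixed modulus of smoothness. -/
theorem jackson_bernstein_stechkin (p α₁ α₂ : ℝ) (hp : 1 < p)
    (hα₁ : 0 < α₁) (hα₂ : 0 < α₂) :
    ∃ C : ℝ, 0 < C ∧ ∀ (f : ℝ → ℝ → ℝ) (n₁ n₂ : ℕ), MemLp0 p f →
      Yapprox p n₁ n₂ f ≤
          ENNReal.ofReal C *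
            mixedMod p α₁ α₂ (π / ((n₁ : ℝ) + 1)) (π / ((n₂ : ℝ) + 1)) f ∧
      mixedMod p α₁ α₂ (π / ((n₁ : ℝ) + 1)) (π / ((n₂ : ℝ) + 1)) f ≤
        ENNReal.ofReal C *
          (ENNReal.ofReal (((n₁ : ℝ) + 1) ^ (-α₁) * ((n₂ : ℝ) + 1) ^ (-α₂)) *
            ∑ ν₁ ∈ Finset.Icc 1 (n₁ + 1), ∑ ν₂ ∈ Finset.Icc 1 (n₂ + 1),
              ENNReal.ofReal ((ν₁ : ℝ) ^ (α₁ - 1) * (ν₂ : ℝ) ^ (α₂ - 1)) *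
                Yapprox p (ν₁ - 1) (ν₂ - 1) f) := by
  have : Fact (1 ≤ ENNReal.ofReal p) := ⟨by simpa using hp.le⟩
  have : Fact (ENNReal.ofReal p ≠ ∞) := ⟨ENNReal.ofReal_ne_top⟩
  obtain ⟨C₁, hC₁, H₁⟩ := PeriodicGroup.exists_norm_angular_sub_le
    (Lp ℝ (ENNReal.ofReal p) (volume : Measure Torus)) hα₁.le hα₂.le
  obtain ⟨C₂, hC₂, H₂⟩ := PeriodicGroup.exists_norm_mixed_le_sum
    (Lp ℝ (ENNReal.ofReal p) (volume : Measure Torus)) hα₁.le hα₂.le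
  refine ⟨C₁ + 16 * C₂ + 1, by positivity, fun f n₁ n₂ hf => ?_⟩
  have hbi : BiPeriodic f := ⟨hf.periodic_x, hf.periodic_y⟩
  have hm := memLp_torusLift hp.le hf.meas hf.norm_ne_top
  set g := hm.toLp
  have hg : g =ᵐ[volume] torusLift f := hm.coeFn_toLp
  constructor
  · obtain ⟨L₁, L₂, hL₁, hL₂, H⟩ := H₁ n₁ n₂
    set ω := mixedMod p α₁ α₂ (π / ((n₁ : ℝ) + 1)) (π / ((n₂ : ℝ) + 1)) f with hω
    rcases eq_or_ne ω ⊤ with htop | htop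
    · rw [htop, ENNReal.mul_top (by simpa using by positivity)]
      exact le_top
    have hbound : ∀ s t : ℝ, |s| ≤ π / ((n₁ : ℝ) + 1) → |t| ≤ π / ((n₂ : ℝ) + 1) →
        ‖oneSubRpow α₁ (translationX (ENNReal.ofReal p) s)
          (oneSubRpow α₂ (translationY (ENNReal.ofReal p) t) g)‖ ≤ ω.toReal := by
      intro s t hs ht
      rw [← ENNReal.ofReal_le_iff_le_toReal htop]
      have := Lp2Norm_diff_eq hp.le hbi hg hα₁.le hα₂.le (-s) (-t)
      rw [neg_neg, neg_neg] at this
      rw [← this]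
      refine le_trans ?_ (le_iSup₂_of_le (-s) (by rwa [abs_neg]) le_rfl)
      exact le_iSup₂_of_le (-t) (by rwa [abs_neg]) le_rfl
    refine (Yapprox_le hp.le hL₁ hL₂ hg).trans ?_
    rw [← ENNReal.ofReal_toReal htop, ← ENNReal.ofReal_mul (by positivity)]
    refine ENNReal.ofReal_le_ofReal ((H _ _ commute_translation g ω.toReal hbound).trans ?_)
    exact mul_le_mul_of_nonneg_right (by linarith) ENNReal.toReal_nonneg
  · refine iSup₂_le fun h₁ hh₁ => iSup₂_le fun h₂ hh₂ => ?_
    rw [Lp2Norm_diff_eq hp.le hbi hg hα₁.le hα₂.le]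
    have key := H₂ _ _ commute_translation n₁ n₂ g (-h₁) (-h₂)
      (conv_vallee_zero_translationX hf.meas hbi hf.mean_x hg)
      (conv_vallee_zero_translationY hf.meas hbi hf.mean_y hg)
      (by rwa [abs_neg]) (by rwa [abs_neg])
    refine (ENNReal.ofReal_le_ofReal key).trans ?_
    rw [ENNReal.ofReal_mul hC₂, ENNReal.ofReal_mul (by positivity),
      ENNReal.ofReal_sum_of_nonneg fun ν₁ _ => Finset.sum_nonneg fun ν₂ _ => by positivity]
    have h16 : ENNReal.ofReal C₂ * 16 ≤ ENNReal.ofReal (C₁ + 16 * C₂ + 1) := by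
      rw [show (16 : ℝ≥0∞) = ENNReal.ofReal 16 by simp, ← ENNReal.ofReal_mul hC₂]
      exact ENNReal.ofReal_le_ofReal (by linarith)
    refine le_trans ?_ (mul_le_mul_left h16 _)
    rw [mul_assoc, mul_left_comm (16 : ℝ≥0∞)]
    gcongr
    rw [Finset.mul_sum]
    refine Finset.sum_le_sum fun ν₁ _ => ?_
    rw [ENNReal.ofReal_sum_of_nonneg fun ν₂ _ => by positivity, Finset.mul_sum]
    refine Finset.sum_le_sum fun ν₂ _ => ?_
    rw [ENNReal.ofReal_mul (by positivity), mul_left_comm (16 : ℝ≥0∞)]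
    gcongr
    exact ofReal_norm_le_Yapprox hp.le _ _ hg

end
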